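/- Let n ≥ 2 and let K ⊂ ℝⁿ be a centrally symmetric convex body (K = −K). If there exists a point X₀ ∈ ∂K at which K has positive generalized Gauss curvature, then K is not a local maximizer for the isotropy constant L among centrally symmetric convex bodies; that is, for every ε > 0 there exists a centrally symmetric convex body K' ⊂ ℝⁿ with Hausdorff distance d(K', K) < ε and L_{K'} > L_K. -/

import Mathlib

open MeasureTheory Metric Set Filter
open scoped InnerProductSpace Topology

noncomputable section

/-- A convex body in ℝⁿ: a compact convex set with nonempty interior. -/
def IsConvexBody {n : ℕ} (K : Set (EuclideanSpace ℝ (Fin n))) : Prop :=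
  IsCompact K ∧ Convex ℝ K ∧ (interior K).Nonempty

/-- The centroid of a set. -/
def centroid {n : ℕ} (K : Set (EuclideanSpace ℝ (Fin n))) : EuclideanSpace ℝ (Fin n) :=
  ((volume K).toReal)⁻¹ • ∫ x in K, x

/-- `(1/n!) ∫_{A}⋯∫_{A} det(X₁ − g, …, Xₙ − g)² dX₁ ⋯ dXₙ`. -/
def detInt {n : ℕ} (A : Set (EuclideanSpace ℝ (Fin n))) (g : EuclideanSpace ℝ (Fin n)) : ℝ :=
  ((n.factorial : ℝ))⁻¹ *
    ∫ X in Set.univ.pi (fun _ : Fin n => A),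
      (Matrix.det (Matrix.of fun i j : Fin n => X j i - g i)) ^ 2
      ∂(Measure.pi fun _ : Fin n => volume)

/-- `M_K^{2n}`, the 2n-th power of the isotropy parameter of a convex body. -/
def Mpow2n {n : ℕ} (K : Set (EuclideanSpace ℝ (Fin n))) : ℝ := detInt K (centroid K)

/-- The isotropy constant `L_K = M_K / |K|^{(n+2)/(2n)}` of a convex body. -/
def isoL (n : ℕ) (K : Set (EuclideanSpace ℝ (Fin n))) : ℝ :=
  (Mpow2n K) ^ ((2 * (n : ℝ)))⁻¹ / (volume K).toReal ^ (((n : ℝ) + 2) / (2 * n))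

/-- `K` is isotropic with isotropy parameter `M`. -/
def IsIsotropic {n : ℕ} (K : Set (EuclideanSpace ℝ (Fin n))) (M : ℝ) : Prop :=
  0 < M ∧ (∫ x in K, x) = 0 ∧
    ∀ y : EuclideanSpace ℝ (Fin n), (∫ x in K, (⟪x, y⟫_ℝ) ^ 2) = M ^ 2 * ‖y‖ ^ 2

/-- `(N, q)` witnesses positive generalized Gauss curvature of `K` at `X₀`. -/
def CurvWitness {n : ℕ} (K : Set (EuclideanSpace ℝ (Fin n))) (X₀ N : EuclideanSpace ℝ (Fin n))
    (q : QuadraticForm ℝ (EuclideanSpace ℝ (Fin n))) : Prop :=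
  ‖N‖ = 1 ∧ (∀ x ∈ K, 0 ≤ ⟪x - X₀, N⟫_ℝ) ∧
  (∀ Y : EuclideanSpace ℝ (Fin n), ⟪Y, N⟫_ℝ = 0 → Y ≠ 0 → 0 < q Y) ∧
  ∀ ε > (0 : ℝ), ∃ a > (0 : ℝ), ∀ (Y : EuclideanSpace ℝ (Fin n)) (y : ℝ), ⟪Y, N⟫_ℝ = 0 →
    X₀ + Y + y • N ∈ frontier K ∩ Metric.ball X₀ a →
    (1 - ε) * q Y ≤ y ∧ y ≤ (1 + ε) * q Y

/-- `K` has positive generalized Gauss curvature at `X₀`. -/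
def HasPosGenCurvature {n : ℕ} (K : Set (EuclideanSpace ℝ (Fin n)))
    (X₀ : EuclideanSpace ℝ (Fin n)) : Prop :=
  ∃ N q, CurvWitness K X₀ N q

/-- `K` is a local maximizer for the isotropy constant (Hausdorff distance). -/
def IsLocalMaxIso {n : ℕ} (K : Set (EuclideanSpace ℝ (Fin n))) : Prop :=
  ∃ ε > (0 : ℝ), ∀ K' : Set (EuclideanSpace ℝ (Fin n)), IsConvexBody K' →
    hausdorffDist K' K < ε → isoL n K' ≤ isoL n K

/-- `K` is a local minimizer for the isotropy constant (Hausdorff distance). -/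
def IsLocalMinIso {n : ℕ} (K : Set (EuclideanSpace ℝ (Fin n))) : Prop :=
  ∃ ε > (0 : ℝ), ∀ K' : Set (EuclideanSpace ℝ (Fin n)), IsConvexBody K' →
    hausdorffDist K' K < ε → isoL n K ≤ isoL n K'

/-- `X₀` is a point of local strict convexity of `∂K`. -/
def IsLocalStrictConvexPoint {n : ℕ} (K : Set (EuclideanSpace ℝ (Fin n)))
    (X₀ : EuclideanSpace ℝ (Fin n)) : Prop :=
  X₀ ∈ frontier K ∧
    ¬ ∃ A B : EuclideanSpace ℝ (Fin n), A ≠ B ∧ segment ℝ A B ⊆ frontier K ∧ X₀ ∈ segment ℝ A B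

/-! ### Determinants of positive matrices -/

lemma one_add_sum_sub_one_le_prod {ι : Type*} (s : Finset ι) (f : ι → ℝ)
    (h : (∀ i, 1 ≤ f i) ∨ ∀ i, 0 ≤ f i ∧ f i ≤ 1) :
    1 + ∑ i ∈ s, (f i - 1) ≤ ∏ i ∈ s, f i := by
  classical
  induction s using Finset.induction_on with
  | empty => simp
  | insert a s ha ih =>
    rw [Finset.sum_insert ha, Finset.prod_insert ha]
    have key : 0 ≤ (f a - 1) * (∏ i ∈ s, f i - 1) := by
      rcases h with h | h
      · have := Finset.one_le_prod (s := s) (f := f) (fun i _ => h i)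
        exact mul_nonneg (by linarith [h a]) (by linarith)
      · have := Finset.prod_le_one (s := s) (f := f) (fun i _ => (h i).1) (fun i _ => (h i).2)
        exact mul_nonneg_of_nonpos_of_nonpos (by linarith [(h a).2]) (by linarith)
    nlinarith

open scoped MatrixOrder ComplexOrder in
lemma one_add_trace_sub_one_le_det {ι : Type*} [Fintype ι] [DecidableEq ι]
    {H : Matrix ι ι ℝ} (hH : H.PosSemidef)
    (h : (H - 1).PosSemidef ∨ (1 - H).PosSemidef) :
    1 + (H - 1).trace ≤ H.det := by
  have hh := hH.isHermitian
  have ev : ∀ (G : Matrix ι ι ℝ) (i : ι),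
      star (⇑(hh.eigenvectorBasis i) : ι → ℝ) ⬝ᵥ (⇑(hh.eigenvectorBasis i) : ι → ℝ) = 1 := by
    intro _ i
    have := hh.eigenvectorBasis.orthonormal.1 i
    rw [EuclideanSpace.norm_eq] at this
    have h2 : ∑ x, ‖(hh.eigenvectorBasis i) x‖ ^ 2 = 1 := by
      simpa using this
    simpa [dotProduct, sq] using h2
  have e1 : H.det = ∏ i, hh.eigenvalues i := by simpa using hh.det_eq_prod_eigenvalues
  have e2 : (H - 1).trace = ∑ i, (hh.eigenvalues i - 1) := by
    rw [Matrix.trace_sub, hh.trace_eq_sum_eigenvalues]; simp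
  rw [e1, e2]
  apply one_add_sum_sub_one_le_prod
  rcases h with h | h
  · left
    intro i
    have := h.dotProduct_mulVec_nonneg (⇑(hh.eigenvectorBasis i) : ι → ℝ)
    rw [Matrix.sub_mulVec, hh.mulVec_eigenvectorBasis, Matrix.one_mulVec, dotProduct_sub,
      dotProduct_smul, ev 0 i] at this
    simpa using this
  · right
    intro i
    refine ⟨hH.eigenvalues_nonneg i, ?_⟩
    have := h.dotProduct_mulVec_nonneg (⇑(hh.eigenvectorBasis i) : ι → ℝ)
    rw [Matrix.sub_mulVec, hh.mulVec_eigenvectorBasis, Matrix.one_mulVec, dotProduct_sub,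
      dotProduct_smul, ev 0 i] at this
    simpa using this

open scoped MatrixOrder ComplexOrder Matrix in
lemma det_mul_one_add_trace_le_det {ι : Type*} [Fintype ι] [DecidableEq ι]
    {A A' : Matrix ι ι ℝ} (hA : A.PosDef) (hA' : A'.PosSemidef)
    (h : (A' - A).PosSemidef ∨ (A - A').PosSemidef) :
    A.det * (1 + (A⁻¹ * (A' - A)).trace) ≤ A'.det := by
  obtain ⟨y, hy, hAy⟩ := CStarAlgebra.isStrictlyPositive_iff_eq_star_mul_self.mp
    hA.isStrictlyPositive
  rw [Matrix.star_eq_conjTranspose] at hAy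
  have hyd : IsUnit y.det := (Matrix.isUnit_iff_isUnit_det _).1 hy
  have hyd' : IsUnit yᴴ.det := by
    rw [Matrix.det_conjTranspose]
    exact IsUnit.star hyd
  have e : ∀ G : Matrix ι ι ℝ, (A⁻¹ * G).trace = ((y⁻¹)ᴴ * G * y⁻¹).trace := by
    intro G
    rw [hAy, Matrix.mul_inv_rev, Matrix.mul_assoc, Matrix.trace_mul_comm,
      Matrix.conjTranspose_nonsing_inv]
  have e1 : (y⁻¹)ᴴ * A * y⁻¹ = 1 := by
    rw [hAy, Matrix.conjTranspose_nonsing_inv, ← Matrix.mul_assoc, Matrix.nonsing_inv_mul _ hyd',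
      Matrix.one_mul, Matrix.mul_nonsing_inv _ hyd]
  have key := one_add_trace_sub_one_le_det (H := (y⁻¹)ᴴ * A' * y⁻¹)
    (hA'.conjTranspose_mul_mul_same _) (by
      rcases h with h | h
      · left
        have := h.conjTranspose_mul_mul_same y⁻¹
        rwa [Matrix.mul_sub, Matrix.sub_mul, e1] at this
      · right
        have := h.conjTranspose_mul_mul_same y⁻¹
        rwa [Matrix.mul_sub, Matrix.sub_mul, e1] at this)
  have e2 : A.det * ((y⁻¹)ᴴ * A' * y⁻¹).det = A'.det := by
    have : A.det * ((y⁻¹)ᴴ * A * y⁻¹).det = A.det := by rw [e1]; simp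
    rw [Matrix.det_mul, Matrix.det_mul] at this ⊢
    have hne := hA.det_pos.ne'
    field_simp at this ⊢
    rw [this, one_mul]
  rw [e, Matrix.mul_sub, Matrix.sub_mul, e1, ← e2]
  exact mul_le_mul_of_nonneg_left key hA.det_pos.le

lemma one_add_pow_le_quadratic (m : ℕ) {w : ℝ} (h1 : -1 ≤ w) (h2 : w ≤ 1) :
    (1 + w) ^ m ≤ 1 + m * w + 4 ^ m * w ^ 2 := by
  induction m with
  | zero => simp; positivity
  | succ m ih =>
    have hm : (m : ℝ) ≤ 4 ^ m := by
      have := (Nat.lt_pow_self (n := m) (a := 4) (by norm_num)).le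
      exact_mod_cast this
    have := mul_le_mul_of_nonneg_right ih (by linarith : 0 ≤ 1 + w)
    rw [pow_succ, pow_succ]
    push_cast
    have hp : (0 : ℝ) < 4 ^ m := by positivity
    nlinarith [mul_nonneg hp.le (mul_nonneg (sq_nonneg w) (by linarith : 0 ≤ 1 - w)),
      mul_nonneg (by linarith : 0 ≤ 4 ^ m - (m : ℝ)) (sq_nonneg w), sq_nonneg w,
      mul_nonneg hp.le (sq_nonneg w)]

/-! ### Second moments and the isotropy constant -/

/-- The matrix of second moments of a set. -/
def secondMoment {n : ℕ} (S : Set (EuclideanSpace ℝ (Fin n))) : Matrix (Fin n) (Fin n) ℝ :=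
  Matrix.of fun i j => ∫ x in S, x i * x j

lemma continuous_coord {n : ℕ} (i : Fin n) : Continuous fun x : EuclideanSpace ℝ (Fin n) => x i := by
  fun_prop

lemma detInt_zero_eq_det {n : ℕ} {K : Set (EuclideanSpace ℝ (Fin n))} (hK : IsCompact K) :
    detInt K 0 = (secondMoment K).det := by
  have hintg : ∀ σ τ : Equiv.Perm (Fin n), Integrable
      (fun X : Fin n → EuclideanSpace ℝ (Fin n) => ∏ j, (X j (σ j) * X j (τ j)))
      (Measure.pi fun _ : Fin n => volume.restrict K) := by
    intro σ τ
    refine Integrable.fintype_prod (f := fun j (x : EuclideanSpace ℝ (Fin n)) =>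
      x (σ j) * x (τ j)) fun j => ?_
    exact ((continuous_coord _).mul (continuous_coord _)).continuousOn.integrableOn_compact hK
  have hdet : ∀ X : Fin n → EuclideanSpace ℝ (Fin n),
      (Matrix.det (Matrix.of fun i j : Fin n => X j i - (0 : EuclideanSpace ℝ (Fin n)) i)) ^ 2
      = ∑ σ : Equiv.Perm (Fin n), ∑ τ : Equiv.Perm (Fin n),
        ((Equiv.Perm.sign σ : ℤ) : ℝ) * ((Equiv.Perm.sign τ : ℤ) : ℝ) *
          ∏ j, (X j (σ j) * X j (τ j)) := by
    intro X
    rw [sq, Matrix.det_apply', Finset.sum_mul_sum]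
    refine Finset.sum_congr rfl fun σ _ => Finset.sum_congr rfl fun τ _ => ?_
    simp only [Matrix.of_apply, PiLp.zero_apply, sub_zero, Finset.prod_mul_distrib]
    ring
  unfold detInt
  rw [Measure.restrict_pi_pi]
  simp_rw [hdet]
  rw [integral_finsetSum _ fun σ _ => integrable_finsetSum _ fun τ _ => (hintg σ τ).const_mul _]
  have hinner : ∀ σ : Equiv.Perm (Fin n),
      (∫ X : Fin n → EuclideanSpace ℝ (Fin n), ∑ τ : Equiv.Perm (Fin n),
        ((Equiv.Perm.sign σ : ℤ) : ℝ) * ((Equiv.Perm.sign τ : ℤ) : ℝ) *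
          ∏ j, (X j (σ j) * X j (τ j)) ∂(Measure.pi fun _ : Fin n => volume.restrict K))
      = (secondMoment K).det := by
    intro σ
    rw [integral_finsetSum _ fun τ _ => (hintg σ τ).const_mul _]
    simp_rw [integral_const_mul]
    have h1 : ∀ τ : Equiv.Perm (Fin n),
        (∫ X : Fin n → EuclideanSpace ℝ (Fin n), ∏ j, (X j (σ j) * X j (τ j))
          ∂(Measure.pi fun _ : Fin n => volume.restrict K))
        = ∏ j, secondMoment K (σ j) (τ j) := fun τ =>
      integral_fintype_prod_eq_prod (fun j (x : EuclideanSpace ℝ (Fin n)) => x (σ j) * x (τ j))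
    simp_rw [h1]
    have h2 := Matrix.det_permute σ (secondMoment K)
    rw [← Matrix.det_transpose, Matrix.det_apply'] at h2
    simp only [Matrix.transpose_apply, Matrix.submatrix_apply, id] at h2
    simp_rw [mul_assoc]
    rw [← Finset.mul_sum, h2, ← mul_assoc, ← Int.cast_mul]
    simp
  simp_rw [hinner]
  rw [Finset.sum_const, Finset.card_univ, Fintype.card_perm, Fintype.card_fin, nsmul_eq_mul,
    ← mul_assoc, inv_mul_cancel₀ (by positivity), one_mul]

lemma centroid_eq_zero {n : ℕ} {K : Set (EuclideanSpace ℝ (Fin n))} (hsym : K = -K) :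
    centroid K = 0 := by
  have h : ∫ x in K, x = -∫ x in K, x := by
    rw [← integral_neg]
    have := (Measure.measurePreserving_neg (volume : Measure (EuclideanSpace ℝ (Fin n)))
      ).setIntegral_preimage_emb (MeasurableEquiv.neg _).measurableEmbedding
      (fun x : EuclideanSpace ℝ (Fin n) => x) K
    have hp : (fun x : EuclideanSpace ℝ (Fin n) => -x) ⁻¹' K = K := hsym.symm
    change ∫ x in (fun x : EuclideanSpace ℝ (Fin n) => -x) ⁻¹' K, -x = _ at this
    rw [hp] at this
    exact this.symm
  have h0 : ∫ x in K, x = 0 := by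
    rw [eq_neg_iff_add_eq_zero, ← two_smul ℝ] at h
    simpa using h
  rw [centroid, h0, smul_zero]

lemma isoL_lt_isoL_of_ratio {n : ℕ} (hn : 0 < n) {K K' : Set (EuclideanSpace ℝ (Fin n))}
    (hK : 0 < (volume K).toReal) (hK' : 0 < (volume K').toReal) (hM : 0 ≤ Mpow2n K)
    (h : Mpow2n K * (volume K').toReal ^ (n + 2) < Mpow2n K' * (volume K).toReal ^ (n + 2)) :
    isoL n K < isoL n K' := by
  have hM' : 0 < Mpow2n K' := by
    have : 0 < Mpow2n K' * (volume K).toReal ^ (n + 2) := lt_of_le_of_lt (by positivity) h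
    exact pos_of_mul_pos_left this (by positivity)
  have key : ∀ S : Set (EuclideanSpace ℝ (Fin n)), 0 < (volume S).toReal → 0 ≤ Mpow2n S →
      isoL n S = (Mpow2n S / (volume S).toReal ^ (n + 2)) ^ ((2 * (n : ℝ)))⁻¹ := by
    intro S hS hMS
    rw [isoL, Real.div_rpow hMS (by positivity), ← Real.rpow_natCast, ← Real.rpow_mul hS.le]
    congr 2
    push_cast
    rw [div_eq_mul_inv]
  rw [key K hK hM, key K' hK' hM'.le]
  apply Real.rpow_lt_rpow (by positivity)
  · rwa [div_lt_div_iff₀ (by positivity) (by positivity)]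
  · positivity

lemma secondMoment_isHermitian {n : ℕ} (S : Set (EuclideanSpace ℝ (Fin n))) :
    (secondMoment S).IsHermitian := by
  ext i j
  simp [secondMoment, mul_comm]

lemma integrableOn_of_continuous {n : ℕ} {S K : Set (EuclideanSpace ℝ (Fin n))} (hK : IsCompact K)
    (hS : S ⊆ K) {f : EuclideanSpace ℝ (Fin n) → ℝ} (hf : Continuous f) :
    IntegrableOn f S :=
  (hf.continuousOn.integrableOn_compact hK).mono_set hS

lemma dotProduct_secondMoment {n : ℕ} {S K : Set (EuclideanSpace ℝ (Fin n))} (hK : IsCompact K)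
    (hS : S ⊆ K) (v : Fin n → ℝ) :
    star v ⬝ᵥ ((secondMoment S).mulVec v) = ∫ x in S, (∑ i, v i * x i) ^ 2 := by
  have h : ∀ x : EuclideanSpace ℝ (Fin n), (∑ i, v i * x i) ^ 2
      = ∑ i, ∑ j, (v i * v j) * (x i * x j) := by
    intro x
    rw [sq, Finset.sum_mul_sum]
    exact Finset.sum_congr rfl fun i _ => Finset.sum_congr rfl fun j _ => by ring
  simp_rw [h]
  rw [integral_finsetSum _ fun i _ => integrableOn_of_continuous hK hS (by fun_prop)]
  simp_rw [fun i => integral_finsetSum (μ := volume.restrict S) Finset.univ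
    (f := fun j (x : EuclideanSpace ℝ (Fin n)) => (v i * v j) * (x i * x j))
    fun j _ => integrableOn_of_continuous hK hS (by fun_prop)]
  simp only [dotProduct, Matrix.mulVec, secondMoment, Matrix.of_apply, integral_const_mul,
    Finset.mul_sum, Pi.star_apply, star_trivial]
  exact Finset.sum_congr rfl fun i _ => Finset.sum_congr rfl fun j _ => by ring

lemma secondMoment_posSemidef {n : ℕ} {S K : Set (EuclideanSpace ℝ (Fin n))} (hK : IsCompact K)
    (hS : S ⊆ K) : (secondMoment S).PosSemidef :=
  Matrix.posSemidef_iff_dotProduct_mulVec.2 ⟨secondMoment_isHermitian S, fun v => by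
    rw [dotProduct_secondMoment hK hS]
    exact integral_nonneg fun x => sq_nonneg _⟩

lemma secondMoment_posDef {n : ℕ} {K : Set (EuclideanSpace ℝ (Fin n))} (hK : IsCompact K)
    (hv : 0 < (volume K).toReal) : (secondMoment K).PosDef := by
  refine Matrix.posDef_iff_dotProduct_mulVec.2 ⟨secondMoment_isHermitian K, fun v hv0 => ?_⟩
  rw [dotProduct_secondMoment hK subset_rfl,
    setIntegral_pos_iff_support_of_nonneg_ae (Eventually.of_forall fun x => sq_nonneg _)
      (integrableOn_of_continuous hK subset_rfl (by fun_prop))]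
  let w : EuclideanSpace ℝ (Fin n) := WithLp.toLp 2 v
  have hw : w ≠ 0 := by
    intro h
    apply hv0
    ext i
    have := congrArg (fun z : EuclideanSpace ℝ (Fin n) => z i) h
    simpa [w] using this
  have hnull : volume ((LinearMap.ker (innerSL ℝ w : _ →L[ℝ] ℝ).toLinearMap :
      Submodule ℝ (EuclideanSpace ℝ (Fin n))) : Set (EuclideanSpace ℝ (Fin n))) = 0 := by
    apply Measure.addHaar_submodule
    intro htop
    have : w ∈ LinearMap.ker (innerSL ℝ w : _ →L[ℝ] ℝ).toLinearMap := by rw [htop]; trivial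
    exact hw (by simpa using this)
  have hsupp : (Function.support fun x : EuclideanSpace ℝ (Fin n) => (∑ i, v i * x i) ^ 2) ∩ K
      = K \ ((LinearMap.ker (innerSL ℝ w : _ →L[ℝ] ℝ).toLinearMap :
      Submodule ℝ (EuclideanSpace ℝ (Fin n))) : Set (EuclideanSpace ℝ (Fin n))) := by
    ext x
    simp [w, PiLp.inner_apply, mul_comm, and_comm]
  rw [hsupp, measure_sdiff_null hnull]
  exact (ENNReal.toReal_pos_iff.1 hv).1

lemma secondMoment_diff {n : ℕ} {K K' : Set (EuclideanSpace ℝ (Fin n))} (hK : IsCompact K)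
    (hK' : IsCompact K') (h : K ⊆ K') :
    secondMoment K' - secondMoment K = secondMoment (K' \ K) := by
  ext i j
  simp only [secondMoment, Matrix.sub_apply, Matrix.of_apply]
  rw [setIntegral_sdiff hK.measurableSet
    (integrableOn_of_continuous hK' subset_rfl (by fun_prop)) h]

/-- The normalised inertia operator of `K`: the inverse of the matrix of second moments. -/
def inertiaOp {n : ℕ} (K : Set (EuclideanSpace ℝ (Fin n))) :
    EuclideanSpace ℝ (Fin n) →L[ℝ] EuclideanSpace ℝ (Fin n) :=
  Matrix.toEuclideanCLM (𝕜 := ℝ) (secondMoment K)⁻¹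

lemma inner_inertiaOp {n : ℕ} (K : Set (EuclideanSpace ℝ (Fin n)))
    (x y : EuclideanSpace ℝ (Fin n)) :
    ⟪x, inertiaOp K y⟫_ℝ = ∑ i, ∑ j, (secondMoment K)⁻¹ i j * (x i * y j) := by
  simp only [inertiaOp, PiLp.inner_apply, Matrix.ofLp_toEuclideanCLM, Matrix.mulVec, dotProduct]
  refine Finset.sum_congr rfl fun i _ => ?_
  simp only [RCLike.inner_apply, conj_trivial, Finset.sum_mul]
  exact Finset.sum_congr rfl fun j _ => by ring

lemma inner_inertiaOp_symm {n : ℕ} (K : Set (EuclideanSpace ℝ (Fin n)))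
    (x y : EuclideanSpace ℝ (Fin n)) : ⟪x, inertiaOp K y⟫_ℝ = ⟪y, inertiaOp K x⟫_ℝ := by
  rw [inner_inertiaOp, inner_inertiaOp, Finset.sum_comm]
  refine Finset.sum_congr rfl fun i _ => Finset.sum_congr rfl fun j _ => ?_
  rw [← (secondMoment_isHermitian K).inv.apply i j]
  simp [mul_comm]

lemma inner_inertiaOp_pos {n : ℕ} {K : Set (EuclideanSpace ℝ (Fin n))} (hK : IsCompact K)
    (hv : 0 < (volume K).toReal) {x : EuclideanSpace ℝ (Fin n)} (hx : x ≠ 0) :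
    0 < ⟪x, inertiaOp K x⟫_ℝ := by
  have h := (secondMoment_posDef hK hv).inv.dotProduct_mulVec_pos (x := fun i => x i)
    (fun h => hx (by ext i; exact congrFun h i))
  rw [inner_inertiaOp]
  simpa [dotProduct, Matrix.mulVec, Finset.mul_sum, mul_comm, mul_left_comm, mul_assoc] using h

lemma trace_inv_mul_secondMoment {n : ℕ} (K : Set (EuclideanSpace ℝ (Fin n)))
    {S T : Set (EuclideanSpace ℝ (Fin n))} (hT : IsCompact T) (hS : S ⊆ T) :
    ((secondMoment K)⁻¹ * secondMoment S).trace = ∫ x in S, ⟪x, inertiaOp K x⟫_ℝ := by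
  simp_rw [inner_inertiaOp]
  rw [integral_finsetSum _ fun i _ => integrableOn_of_continuous hT hS (by fun_prop)]
  simp_rw [fun i => integral_finsetSum (μ := volume.restrict S) Finset.univ
    (f := fun j (x : EuclideanSpace ℝ (Fin n)) => (secondMoment K)⁻¹ i j * (x i * x j))
    fun j _ => integrableOn_of_continuous hT hS (by fun_prop)]
  simp only [Matrix.trace, Matrix.diag, Matrix.mul_apply, integral_const_mul, secondMoment,
    Matrix.of_apply]
  exact Finset.sum_congr rfl fun i _ => Finset.sum_congr rfl fun j _ => by
    simp_rw [mul_comm]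

lemma isoL_lt_isoL_of_trace {n : ℕ} (hn : 0 < n) {K K' : Set (EuclideanSpace ℝ (Fin n))}
    (hK : IsCompact K) (hK' : IsCompact K') (hs : K = -K) (hs' : K' = -K')
    (hv : 0 < (volume K).toReal) (hv' : 0 < (volume K').toReal) {w : ℝ} (h1 : -1 ≤ w) (h2 : w ≤ 1)
    (hw : (volume K').toReal = (volume K).toReal * (1 + w))
    (hsub : (secondMoment K' - secondMoment K).PosSemidef ∨
      (secondMoment K - secondMoment K').PosSemidef)
    (ht : ((n + 2 : ℕ) : ℝ) * w + 4 ^ (n + 2) * w ^ 2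
      < ((secondMoment K)⁻¹ * (secondMoment K' - secondMoment K)).trace) :
    isoL n K < isoL n K' := by
  have hA := secondMoment_posDef hK hv
  have e : ∀ S : Set (EuclideanSpace ℝ (Fin n)), IsCompact S → S = -S →
      Mpow2n S = (secondMoment S).det := fun S hS hSs => by
    rw [Mpow2n, centroid_eq_zero hSs, detInt_zero_eq_det hS]
  have hd := hA.det_pos
  apply isoL_lt_isoL_of_ratio hn hv hv'
  · rw [e K hK hs]; exact hd.le
  rw [e K hK hs, e K' hK' hs', hw, mul_pow]
  have k1 := det_mul_one_add_trace_le_det hA (secondMoment_posSemidef hK' subset_rfl) hsub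
  have k2 := one_add_pow_le_quadratic (n + 2) h1 h2
  have k3 : (secondMoment K).det * (1 + w) ^ (n + 2) < (secondMoment K').det :=
    lt_of_lt_of_le (mul_lt_mul_of_pos_left (by linarith) hd) k1
  have hp : 0 < (volume K).toReal ^ (n + 2) := by positivity
  nlinarith

/-- The first variation density of the isotropy constant at `K`. -/
def isoDensity {n : ℕ} (K : Set (EuclideanSpace ℝ (Fin n))) (x : EuclideanSpace ℝ (Fin n)) : ℝ :=
  ⟪x, inertiaOp K x⟫_ℝ - (n + 2) / (volume K).toReal

lemma continuous_isoDensity {n : ℕ} (K : Set (EuclideanSpace ℝ (Fin n))) :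
    Continuous (isoDensity K) := by
  unfold isoDensity
  fun_prop

lemma setIntegral_isoDensity {n : ℕ} (K : Set (EuclideanSpace ℝ (Fin n)))
    {S T : Set (EuclideanSpace ℝ (Fin n))} (hT : IsCompact T) (hS : S ⊆ T) :
    ∫ x in S, isoDensity K x = (∫ x in S, ⟪x, inertiaOp K x⟫_ℝ)
      - (n + 2) / (volume K).toReal * (volume S).toReal := by
  have hfin : volume S ≠ ⊤ := (measure_mono hS).trans_lt hT.measure_lt_top |>.ne
  unfold isoDensity
  rw [integral_sub (integrableOn_of_continuous hT hS (by fun_prop))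
    (integrableOn_const hfin)]
  simp [Measure.real, mul_comm]

lemma isoL_lt_isoL_of_superset {n : ℕ} (hn : 0 < n) {K K' : Set (EuclideanSpace ℝ (Fin n))}
    (hK : IsCompact K) (hK' : IsCompact K') (hs : K = -K) (hs' : K' = -K')
    (hv : 0 < (volume K).toReal) (hsub : K ⊆ K')
    (hV : (volume (K' \ K)).toReal ≤ (volume K).toReal)
    (h : 4 ^ (n + 2) / (volume K).toReal ^ 2 * (volume (K' \ K)).toReal ^ 2
      < ∫ x in K' \ K, isoDensity K x) :
    isoL n K < isoL n K' := by
  have hvol : (volume K').toReal = (volume K).toReal + (volume (K' \ K)).toReal := by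
    have h1 := measureReal_sdiff (μ := volume) hsub hK.measurableSet (h₁ := hK'.measure_lt_top.ne)
    simp only [Measure.real] at h1
    rw [h1]; ring
  have hV0 : 0 ≤ (volume (K' \ K)).toReal := ENNReal.toReal_nonneg
  refine isoL_lt_isoL_of_trace hn hK hK' hs hs' hv (by rw [hvol]; linarith)
    (w := (volume (K' \ K)).toReal / (volume K).toReal) ?_ ((div_le_one hv).2 hV) ?_ ?_ ?_
  · exact le_trans (by norm_num) (div_nonneg hV0 hv.le)
  · rw [hvol]; field_simp
  · left; rw [secondMoment_diff hK hK' hsub]; exact secondMoment_posSemidef hK' sdiff_subset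
  · rw [secondMoment_diff hK hK' hsub, trace_inv_mul_secondMoment K hK' sdiff_subset]
    rw [setIntegral_isoDensity K hK' sdiff_subset] at h
    push_cast
    have e1 : ((n : ℝ) + 2) * ((volume (K' \ K)).toReal / (volume K).toReal)
      = (n + 2) / (volume K).toReal * (volume (K' \ K)).toReal := by ring
    rw [e1, div_pow, mul_div_assoc', ← div_mul_eq_mul_div]
    linarith

lemma isoL_lt_isoL_of_subset {n : ℕ} (hn : 0 < n) {K K' : Set (EuclideanSpace ℝ (Fin n))}
    (hK : IsCompact K) (hK' : IsCompact K') (hs : K = -K) (hs' : K' = -K')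
    (hv' : 0 < (volume K').toReal) (hsub : K' ⊆ K)
    (h : ∫ x in K \ K', isoDensity K x
      < -(4 ^ (n + 2) / (volume K).toReal ^ 2 * (volume (K \ K')).toReal ^ 2)) :
    isoL n K < isoL n K' := by
  have hvol : (volume K').toReal = (volume K).toReal - (volume (K \ K')).toReal := by
    have h1 := measureReal_sdiff (μ := volume) hsub hK'.measurableSet (h₁ := hK.measure_lt_top.ne)
    simp only [Measure.real] at h1
    rw [h1]; ring
  have hV0 : 0 ≤ (volume (K \ K')).toReal := ENNReal.toReal_nonneg
  have hv : 0 < (volume K).toReal := by linarith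
  refine isoL_lt_isoL_of_trace hn hK hK' hs hs' hv hv'
    (w := -((volume (K \ K')).toReal / (volume K).toReal)) ?_ ?_ ?_ ?_ ?_
  · exact neg_le_neg ((div_le_one hv).2 (by linarith))
  · exact le_trans (neg_nonpos.2 (div_nonneg hV0 hv.le)) (by norm_num)
  · rw [hvol]; field_simp; ring
  · right; rw [secondMoment_diff hK' hK hsub]; exact secondMoment_posSemidef hK sdiff_subset
  · rw [← neg_sub (secondMoment K), secondMoment_diff hK' hK hsub, Matrix.mul_neg,
      Matrix.trace_neg, trace_inv_mul_secondMoment K hK sdiff_subset]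
    rw [setIntegral_isoDensity K hK sdiff_subset] at h
    push_cast
    have e1 : ((n : ℝ) + 2) * -((volume (K \ K')).toReal / (volume K).toReal)
      = -((n + 2) / (volume K).toReal * (volume (K \ K')).toReal) := by ring
    rw [e1, neg_sq, div_pow, mul_div_assoc', ← div_mul_eq_mul_div]
    linarith

/-! ### Local geometry at a point of positive generalized curvature -/

lemma eventually_mul_lt (b : ℝ) {c : ℝ} (hc : 0 < c) : ∀ᶠ r in 𝓝[>] (0 : ℝ), b * r < c := by
  have h : Tendsto (fun r : ℝ => b * r) (𝓝[>] 0) (𝓝 0) := by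
    have : Tendsto (fun r : ℝ => b * r) (𝓝 0) (𝓝 (b * 0)) := tendsto_id.const_mul b
    rw [mul_zero] at this
    exact this.mono_left nhdsWithin_le_nhds
  exact h.eventually_lt_const hc

lemma eventually_pos_nhdsGT : ∀ᶠ r in 𝓝[>] (0 : ℝ), 0 < r := self_mem_nhdsWithin

section Local

variable {E : Type*} [NormedAddCommGroup E] [InnerProductSpace ℝ E]

/-- `C` contains the origin, lies above the hyperplane `Nᗮ`, and near the origin its boundary is
asymptotic to the graph of the quadratic form `z ↦ B z z`, which is degenerate along `N` only. -/
structure Osculates (C : Set E) (N : E) (B : E →ₗ[ℝ] E →ₗ[ℝ] ℝ) : Prop where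
  isCompact : IsCompact C
  convex : Convex ℝ C
  zero_mem : (0 : E) ∈ C
  inner_nonneg : ∀ z ∈ C, 0 ≤ ⟪z, N⟫_ℝ
  exists_inner_pos : ∃ w ∈ C, 0 < ⟪w, N⟫_ℝ
  norm_eq_one : ‖N‖ = 1
  symm : ∀ u v, B u v = B v u
  ker : ∀ z, B N z = 0
  nonneg : ∀ z, 0 ≤ B z z
  lower : ∃ m > 0, ∀ z, m * ‖z‖ ^ 2 ≤ B z z + ⟪z, N⟫_ℝ ^ 2
  upper : ∃ M > 0, ∀ z, B z z ≤ M * ‖z‖ ^ 2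
  curv : ∀ ε > 0, ∃ a > 0, ∀ z ∈ frontier C, ‖z‖ < a →
    (1 - ε) * B z z ≤ ⟪z, N⟫_ℝ ∧ ⟪z, N⟫_ℝ ≤ (1 + ε) * B z z

lemma exists_mem_frontier_of_notMem {C : Set E} (hC : IsClosed C) {x w : E} (hx : x ∉ C)
    (hw : w ∈ C) : ∃ t : ℝ, 0 < t ∧ t ≤ 1 ∧ x + t • (w - x) ∈ frontier C := by
  by_contra! hcon
  have hcon' : ∀ y ∈ segment ℝ x w, y ∉ frontier C := by
    intro y hy hyf
    rw [segment_eq_image'] at hy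
    obtain ⟨t, ⟨ht0, ht1⟩, rfl⟩ := hy
    rcases ht0.eq_or_lt with h | h
    · subst h
      exact hx (by simpa using hC.frontier_subset hyf)
    · exact hcon t h ht1 hyf
  have hpre : IsPreconnected (segment ℝ x w) := (convex_segment x w).isPreconnected
  have hmem : ∀ y ∈ segment ℝ x w, y ∈ C → y ∈ interior C := by
    intro y hy hyC
    by_contra hyi
    exact hcon' y hy (by rw [hC.frontier_eq]; exact ⟨hyC, hyi⟩)
  obtain ⟨y, -, hy1, hy2⟩ := hpre (interior C) Cᶜ isOpen_interior hC.isOpen_compl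
    (fun y hy => by
      by_cases h : y ∈ C
      · exact Or.inl (hmem y hy h)
      · exact Or.inr h)
    ⟨w, right_mem_segment ℝ x w, hmem w (right_mem_segment ℝ x w) hw⟩
    ⟨x, left_mem_segment ℝ x w, hx⟩
  exact hy2 (interior_subset hy1)

namespace Osculates

variable {C : Set E} {N : E} {B : E →ₗ[ℝ] E →ₗ[ℝ] ℝ}

lemma apply_add (h : Osculates C N B) (u v : E) (s : ℝ) :
    B (u + s • v) (u + s • v) = B u u + s * (2 * B u v) + s ^ 2 * B v v := by
  simp only [map_add, map_smul, LinearMap.add_apply, LinearMap.smul_apply, smul_eq_mul]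
  rw [h.symm v u]; ring

lemma apply_add_smul_normal (h : Osculates C N B) (u : E) (s : ℝ) :
    B (u + s • N) (u + s • N) = B u u := by
  rw [h.apply_add, h.symm u N, h.ker, h.ker]; ring

lemma inner_self (h : Osculates C N B) : ⟪N, N⟫_ℝ = 1 := by
  rw [real_inner_self_eq_norm_sq, h.norm_eq_one]; norm_num

/-- Points above the osculating graph belong to the set. -/
lemma mem_of_le (h : Osculates C N B) {ε : ℝ} (hε : 0 < ε) :
    ∃ a > 0, ∀ z, ‖z‖ < a → (1 + ε) * B z z ≤ ⟪z, N⟫_ℝ → z ∈ C := by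
  obtain ⟨a, ha, hc⟩ := h.curv ε hε
  obtain ⟨w, hw, hwN⟩ := h.exists_inner_pos
  refine ⟨a, ha, fun x hx hxN => ?_⟩
  by_contra hxC
  obtain ⟨τ, hτ, hτ1, hτ2, hτ3⟩ := (eventually_pos_nhdsGT.and ((eventually_mul_lt 1 one_pos).and
    ((eventually_mul_lt ‖w‖ ha).and (eventually_mul_lt ((1 + ε) * B w w) hwN)))).exists
  have hw' : τ • w ∈ C := by
    have := h.convex h.zero_mem hw (by linarith : 0 ≤ 1 - τ) hτ.le (by ring)
    simpa using this
  obtain ⟨t, ht0, ht1, hz⟩ := exists_mem_frontier_of_notMem h.isCompact.isClosed hxC hw'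
  have hnorm : ‖x + t • (τ • w - x)‖ < a := by
    have hb := (convex_ball (0 : E) a) (x := x) (by simpa using hx) (y := τ • w)
      (by simpa [norm_smul, abs_of_pos hτ, mul_comm] using hτ2)
      (by linarith : 0 ≤ 1 - t) ht0.le (by ring)
    rw [mem_ball_zero_iff] at hb
    have e : x + t • (τ • w - x) = (1 - t) • x + t • τ • w := by module
    rwa [e]
  have h1 := (hc _ hz hnorm).2
  have e1 : B (x + t • (τ • w - x)) (x + t • (τ • w - x))
      = (1 - t) * B x x + t * B (τ • w) (τ • w)
        - t * (1 - t) * B (τ • w - x) (τ • w - x) := by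
    simp only [map_add, map_sub, map_smul, LinearMap.add_apply, LinearMap.sub_apply,
      LinearMap.smul_apply, smul_eq_mul]
    rw [h.symm w x]; ring
  have e2 : ⟪x + t • (τ • w - x), N⟫_ℝ = (1 - t) * ⟪x, N⟫_ℝ + t * (τ * ⟪w, N⟫_ℝ) := by
    simp only [inner_add_left, inner_sub_left, real_inner_smul_left]; ring
  have e3 : B (τ • w) (τ • w) = τ ^ 2 * B w w := by simp; ring
  rw [e1, e2, e3] at h1
  have k1 : 0 ≤ (1 + ε) * (t * (1 - t) * B (τ • w - x) (τ • w - x)) :=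
    mul_nonneg (by linarith) (mul_nonneg (mul_nonneg ht0.le (by linarith)) (h.nonneg _))
  have k2 : 0 < t * (τ * (⟪w, N⟫_ℝ - (1 + ε) * B w w * τ)) :=
    mul_pos ht0 (mul_pos hτ (by linarith))
  have k3 := mul_le_mul_of_nonneg_left hxN (by linarith : 0 ≤ 1 - t)
  nlinarith

/-- Points of the set lie above the osculating graph. -/
lemma le_inner_of_mem (h : Osculates C N B) {ε : ℝ} (hε : 0 < ε) :
    ∃ a > 0, ∀ z ∈ C, ‖z‖ < a → (1 - ε) * B z z ≤ ⟪z, N⟫_ℝ := by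
  obtain ⟨a, ha, hc⟩ := h.curv ε hε
  refine ⟨a, ha, fun z hz hza => ?_⟩
  have hNN := h.inner_self
  have hzN := h.inner_nonneg z hz
  have hx : z - (⟪z, N⟫_ℝ + 1) • N ∉ C := fun hx => by
    have := h.inner_nonneg _ hx
    rw [inner_sub_left, real_inner_smul_left, hNN] at this
    linarith
  obtain ⟨t, ht0, ht1, hf⟩ := exists_mem_frontier_of_notMem h.isCompact.isClosed hx hz
  set c := (1 - t) * (⟪z, N⟫_ℝ + 1) with hcdef
  have hc0 : 0 ≤ c := mul_nonneg (by linarith) (by linarith)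
  have e : z - (⟪z, N⟫_ℝ + 1) • N + t • (z - (z - (⟪z, N⟫_ℝ + 1) • N)) = z + (-c) • N := by
    rw [hcdef]; module
  rw [e] at hf
  have hin : ⟪z + (-c) • N, N⟫_ℝ = ⟪z, N⟫_ℝ - c := by
    rw [inner_add_left, real_inner_smul_left, hNN]; ring
  have hpos := h.inner_nonneg _ (h.isCompact.isClosed.frontier_subset hf)
  rw [hin] at hpos
  have hnorm : ‖z + (-c) • N‖ < a := by
    have : ‖z + (-c) • N‖ ^ 2 ≤ ‖z‖ ^ 2 := by
      rw [norm_add_sq_real, real_inner_smul_right, norm_smul, h.norm_eq_one, Real.norm_eq_abs,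
        mul_one, sq_abs]
      nlinarith
    exact lt_of_le_of_lt (le_of_sq_le_sq this (norm_nonneg _)) hza
  have h1 := (hc _ hf hnorm).1
  rw [h.apply_add_smul_normal, hin] at h1
  linarith

/-- Away from the origin the set stays at positive height. -/
lemma exists_pos_le_inner (h : Osculates C N B) {a : ℝ} (ha : 0 < a) :
    ∃ κ > 0, ∀ z ∈ C, a ≤ ‖z‖ → κ ≤ ⟪z, N⟫_ℝ := by
  have hcomp : IsCompact (C ∩ {z | a ≤ ‖z‖}) :=
    h.isCompact.inter_right (isClosed_le continuous_const continuous_norm)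
  rcases (C ∩ {z | a ≤ ‖z‖}).eq_empty_or_nonempty with he | hne
  · exact ⟨1, one_pos, fun z hz hza => absurd (show z ∈ C ∩ {z | a ≤ ‖z‖} from ⟨hz, hza⟩)
      (by rw [he]; simp)⟩
  obtain ⟨z, ⟨hz, hza⟩, hmin⟩ := hcomp.exists_isMinOn hne
    (f := fun z => ⟪z, N⟫_ℝ) (by fun_prop)
  refine ⟨⟪z, N⟫_ℝ, ?_, fun y hy hya => hmin ⟨hy, hya⟩⟩
  by_contra hcon
  have hzN : ⟪z, N⟫_ℝ = 0 := le_antisymm (not_lt.1 hcon) (h.inner_nonneg z hz)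
  obtain ⟨a', ha', hA⟩ := h.le_inner_of_mem (ε := 1 / 2) (by norm_num)
  obtain ⟨t, ht, ht1, ht2⟩ := (eventually_pos_nhdsGT.and ((eventually_mul_lt 1 one_pos).and
    (eventually_mul_lt ‖z‖ ha'))).exists
  have htz : t • z ∈ C := by
    have := h.convex h.zero_mem hz (by linarith : 0 ≤ 1 - t) ht.le (by ring)
    simpa using this
  have h1 := hA _ htz (by simpa [norm_smul, abs_of_pos ht, mul_comm] using ht2)
  rw [real_inner_smul_left, hzN] at h1
  have e : B (t • z) (t • z) = t ^ 2 * B z z := by simp; ring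
  rw [e] at h1
  have h2 : B z z ≤ 0 := by
    by_contra hb
    have : 0 < t ^ 2 * B z z := mul_pos (by positivity) (not_le.1 hb)
    linarith
  obtain ⟨m, hm, hlow⟩ := h.lower
  have h3 := hlow z
  rw [hzN] at h3
  have : 0 < m * ‖z‖ ^ 2 := by
    have : 0 < ‖z‖ := lt_of_lt_of_le ha hza
    positivity
  linarith

lemma apply_pos (h : Osculates C N B) {Y : E} (hY : ⟪Y, N⟫_ℝ = 0) (hY0 : Y ≠ 0) :
    0 < B Y Y := by
  obtain ⟨m, hm, hlow⟩ := h.lower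
  have h3 := hlow Y
  rw [hY] at h3
  have : 0 < m * ‖Y‖ ^ 2 := by
    have : 0 < ‖Y‖ := norm_pos_iff.2 hY0
    positivity
  linarith

/-- Low caps are small. -/
lemma exists_norm_le_of_inner_lt (h : Osculates C N B) :
    ∃ c > 0, ∀ᶠ r in 𝓝[>] (0 : ℝ), ∀ z ∈ C, ⟪z, N⟫_ℝ < r ^ 2 → ‖z‖ ≤ c * r := by
  obtain ⟨m, hm, hlow⟩ := h.lower
  obtain ⟨a, ha, hA⟩ := h.le_inner_of_mem (ε := 1 / 2) (by norm_num)
  obtain ⟨κ, hκ, hK⟩ := h.exists_pos_le_inner ha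
  refine ⟨√(3 / m), by positivity, ?_⟩
  filter_upwards [eventually_pos_nhdsGT, eventually_mul_lt 1 one_pos, eventually_mul_lt 1 hκ]
    with r hr hr1 hrκ z hz hzr
  have hza : ‖z‖ < a := by
    by_contra hcon
    have := hK z hz (not_lt.1 hcon)
    nlinarith
  have h1 := hA z hz hza
  have h2 := hlow z
  have h3 := h.inner_nonneg z hz
  have h6 : r ^ 2 ≤ 1 := by nlinarith
  have h7 : ⟪z, N⟫_ℝ ^ 2 ≤ r ^ 2 := by nlinarith
  have h4 : m * ‖z‖ ^ 2 ≤ 3 * r ^ 2 := by linarith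
  have h5 : ‖z‖ ^ 2 ≤ (√(3 / m) * r) ^ 2 := by
    rw [mul_pow, Real.sq_sqrt (by positivity), div_mul_eq_mul_div, le_div_iff₀ hm]
    linarith
  exact le_of_sq_le_sq h5 (by positivity)

end Osculates

end Local

namespace Osculates

variable {E : Type*} [NormedAddCommGroup E] [InnerProductSpace ℝ E] {C : Set E} {N : E}
  {B : E →ₗ[ℝ] E →ₗ[ℝ] ℝ}

lemma inner_add_smul_sub (u v w : E) (s : ℝ) :
    ⟪u + s • (v - u), w⟫_ℝ = (1 - s) * ⟪u, w⟫_ℝ + s * ⟪v, w⟫_ℝ := by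
  simp only [inner_add_left, inner_sub_left, real_inner_smul_left]; ring

lemma apply_add_smul_sub (h : Osculates C N B) (u v : E) (s : ℝ) :
    B (u + s • (v - u)) (u + s • (v - u))
      = (1 - s) * B u u + s * B v v - s * (1 - s) * B (v - u) (v - u) := by
  simp only [map_add, map_sub, map_smul, LinearMap.add_apply, LinearMap.sub_apply,
    LinearMap.smul_apply, smul_eq_mul]
  rw [h.symm v u]; ring

lemma apply_add_le (h : Osculates C N B) (u v : E) (s : ℝ) :
    B (u + s • v) (u + s • v) ≤ 2 * B u u + 2 * (s ^ 2 * B v v) := by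
  have h1 := h.nonneg (u + (-s) • v)
  rw [h.apply_add] at h1 ⊢
  nlinarith

/-- Quantitative core of the bump construction: if a chord from a point of `B`-height `q₀` stays
below the osculating graph, then it is short in the `B`-direction. -/
lemma sq_mul_apply_le (h : Osculates C N B) {ε q₀ : ℝ} (hε : 0 < ε) (hε' : ε ≤ 1 / 16) {P k : E}
    (hP : B P P = q₀) (hPN : ⟪P, N⟫_ℝ = (1 - 2 * ε) * q₀)
    (hk : (1 - ε) * B k k ≤ ⟪k, N⟫_ℝ) {s₀ : ℝ} (hs₀ : 0 ≤ s₀) (hs₁ : s₀ ≤ 1)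
    (hlow : ∀ s, 0 ≤ s → s ≤ s₀ →
      ⟪P + s • (k - P), N⟫_ℝ ≤ (1 + ε) * B (P + s • (k - P)) (P + s • (k - P))) :
    s₀ ^ 2 * B (k - P) (k - P) ≤ 48 * ε * q₀ := by
  set γ := B (k - P) (k - P) with hγ
  have hγ0 : 0 ≤ γ := h.nonneg _
  have key : ∀ s, 0 ≤ s → s ≤ s₀ → s ≤ 1 / 2 → s * γ ≤ 24 * ε * q₀ := by
    intro s hs hss hs2
    have h1 := hlow s hs hss
    have h2 := h.apply_add_smul_sub P k s
    have h3 := h.apply_add_le P (k - P) s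
    rw [← hγ, hP] at h2 h3
    rw [inner_add_smul_sub, hPN] at h1
    set p := B (P + s • (k - P)) (P + s • (k - P)) with hp
    have hk0 := h.nonneg k
    have hp0 : 0 ≤ p := h.nonneg _
    have h4 : (1 - 2 * ε) * (p + s * (1 - s) * γ) ≤ (1 + ε) * p := by
      have : s * ((1 - 2 * ε) * B k k) ≤ s * ⟪k, N⟫_ℝ :=
        mul_le_mul_of_nonneg_left (by nlinarith) hs
      have e : (1 - 2 * ε) * (p + s * (1 - s) * γ)
          = (1 - s) * ((1 - 2 * ε) * q₀) + s * ((1 - 2 * ε) * B k k) := by rw [h2]; ring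
      linarith
    have h5 : (1 - 2 * ε) * (s * (1 - s) * γ) ≤ 3 * ε * p := by linarith
    have hsγ : 0 ≤ s * γ := mul_nonneg hs hγ0
    have h6 : p ≤ 2 * q₀ + s * γ := by nlinarith
    have h7 : 7 / 16 * (s * γ) ≤ (1 - 2 * ε) * (s * (1 - s) * γ) := by
      have : 7 / 16 ≤ (1 - 2 * ε) * (1 - s) := by nlinarith
      calc 7 / 16 * (s * γ) ≤ ((1 - 2 * ε) * (1 - s)) * (s * γ) :=
            mul_le_mul_of_nonneg_right this hsγ
        _ = _ := by ring
    have h8 : 3 * ε * p ≤ 3 * ε * (2 * q₀ + s * γ) :=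
      mul_le_mul_of_nonneg_left h6 (by linarith)
    have h9 : ε * (s * γ) ≤ 1 / 16 * (s * γ) := mul_le_mul_of_nonneg_right hε' hsγ
    linarith
  have hq : s₀ * γ ≤ 48 * ε * q₀ := by
    have := key (s₀ / 2) (by linarith) (by linarith) (by linarith)
    linarith
  nlinarith [mul_nonneg hs₀ hγ0]

/-- Adding a suitable point just below the graph enlarges `C` only close to a prescribed tangential
position and only below the graph. -/
lemma exists_notMem_forall_segment (h : Osculates C N B) {Y₀ : E} (hY : ⟪Y₀, N⟫_ℝ = 0)
    (hY0 : Y₀ ≠ 0) {η : ℝ} (hη : 0 < η) :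
    ∀ᶠ r in 𝓝[>] (0 : ℝ), ∃ P, P ∉ C ∧ ∀ k ∈ C, ∀ s : ℝ, 0 ≤ s → s ≤ 1 →
      P + s • (k - P) ∉ C → ‖P + s • (k - P) - r • Y₀‖ ≤ η * r ∧
        0 ≤ ⟪P + s • (k - P), N⟫_ℝ ∧
        ⟪P + s • (k - P), N⟫_ℝ ≤ (1 + η) * B (P + s • (k - P)) (P + s • (k - P)) := by
  obtain ⟨m, hm, hlow⟩ := h.lower
  obtain ⟨M, hM, hup⟩ := h.upper
  set β₀ := B Y₀ Y₀ with hβ₀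
  have hβpos : 0 < β₀ := h.apply_pos hY hY0
  obtain ⟨ε, hε, hεη, hε16, hεm⟩ : ∃ ε > 0, ε ≤ η ∧ ε ≤ 1 / 16 ∧ 48 * ε * β₀ ≤ m * η ^ 2 / 2 := by
    refine ⟨min (min η (1 / 16)) (m * η ^ 2 / (96 * β₀)), by positivity,
      (min_le_left _ _).trans (min_le_left _ _), (min_le_left _ _).trans (min_le_right _ _), ?_⟩
    have := min_le_right (min η (1 / 16)) (m * η ^ 2 / (96 * β₀))
    rw [le_div_iff₀ (by positivity)] at this
    linarith
  obtain ⟨a₁, ha₁, hA⟩ := h.le_inner_of_mem hε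
  obtain ⟨a₂, ha₂, hB⟩ := h.mem_of_le hε
  obtain ⟨a, ha, haa₁, haa₂⟩ : ∃ a > 0, a ≤ a₁ ∧ a ≤ a₂ :=
    ⟨min a₁ a₂, lt_min ha₁ ha₂, min_le_left _ _, min_le_right _ _⟩
  obtain ⟨κ, hκ, hfar⟩ := h.exists_pos_le_inner ha
  obtain ⟨D, hD, hCD⟩ := h.isCompact.isBounded.exists_pos_norm_le
  set l := η / (2 * (D + 1)) with hl
  have hl0 : 0 < l := by positivity
  have hlD : l * (D + 1) = η / 2 := by rw [hl]; field_simp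
  set c := ‖Y₀‖ + β₀ with hc
  have hc0 : 0 < c := by positivity
  filter_upwards [eventually_pos_nhdsGT, eventually_mul_lt 1 one_pos, eventually_mul_lt c ha,
    eventually_mul_lt c one_pos, eventually_mul_lt (c + η) ha,
    eventually_mul_lt (256 * β₀ ^ 2) (show 0 < m * η ^ 2 / 2 by positivity),
    eventually_mul_lt (2 * M * (c + η) ^ 2) (mul_pos hl0 hκ),
    eventually_mul_lt β₀ (half_pos hη)] with r hr hr1 hca hc1 hcηa h256 hMr hβη
  rw [one_mul] at hr1
  set q₀ := r ^ 2 * β₀ with hq₀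
  have hq₀pos : 0 < q₀ := by positivity
  have hrr : r ^ 2 ≤ r := by rw [sq]; exact mul_le_of_le_one_left hr.le hr1.le
  set P := r • Y₀ + ((1 - 2 * ε) * q₀) • N with hPdef
  have hPB : B P P = q₀ := by
    rw [hPdef, h.apply_add_smul_normal, map_smul, map_smul, LinearMap.smul_apply, smul_eq_mul,
      smul_eq_mul, ← hβ₀, hq₀]; ring
  have hPN : ⟪P, N⟫_ℝ = (1 - 2 * ε) * q₀ := by
    rw [hPdef, inner_add_left, real_inner_smul_left, real_inner_smul_left, hY, h.inner_self]; ring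
  have hPr : ‖P - r • Y₀‖ ≤ β₀ * r ^ 2 := by
    have e : P - r • Y₀ = ((1 - 2 * ε) * q₀) • N := by rw [hPdef]; abel
    rw [e, norm_smul, h.norm_eq_one, Real.norm_eq_abs, mul_one,
      abs_of_nonneg (mul_nonneg (by linarith) hq₀pos.le)]
    linarith [mul_nonneg hε.le hq₀pos.le]
  have hPc : ‖P‖ ≤ c * r := by
    calc ‖P‖ = ‖r • Y₀ + (P - r • Y₀)‖ := by congr 1; abel
      _ ≤ ‖r • Y₀‖ + ‖P - r • Y₀‖ := norm_add_le _ _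
      _ ≤ r * ‖Y₀‖ + β₀ * r := by
        rw [norm_smul, Real.norm_eq_abs, abs_of_pos hr]
        have := mul_le_mul_of_nonneg_left hrr hβpos.le
        linarith
      _ = c * r := by rw [hc]; ring
  have hPa : ‖P‖ < a := lt_of_le_of_lt hPc hca
  have hP1 : ‖P‖ < 1 := lt_of_le_of_lt hPc hc1
  refine ⟨P, fun hPC => ?_, fun k hk s₀ hs₀ hs₁ hx => ?_⟩
  · have := hA P hPC (hPa.trans_le haa₁)
    rw [hPB, hPN] at this
    linarith [mul_pos hε hq₀pos]
  have hkN := h.inner_nonneg k hk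
  have hPN0 : 0 ≤ ⟪P, N⟫_ℝ := by rw [hPN]; exact mul_nonneg (by linarith) hq₀pos.le
  have hout : ∀ s, 0 ≤ s → s ≤ s₀ → P + s • (k - P) ∉ C := by
    intro s hs hss hmem
    rcases hs₁.eq_or_lt with h1 | h1
    · exact hx (by rw [h1, one_smul]; simpa using hk)
    have h1s : 0 < 1 - s := by linarith
    refine hx ?_
    have := h.convex hmem hk (a := (1 - s₀) / (1 - s)) (b := (s₀ - s) / (1 - s))
      (div_nonneg (by linarith) h1s.le) (div_nonneg (by linarith) h1s.le) (by field_simp; ring)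
    convert this using 1
    have e : s₀ = (1 - s₀) / (1 - s) * s + (s₀ - s) / (1 - s) := by field_simp; ring
    have e' : 1 = (1 - s₀) / (1 - s) + (s₀ - s) / (1 - s) := by field_simp; ring
    generalize (1 - s₀) / (1 - s) = A at *
    generalize (s₀ - s) / (1 - s) = A' at *
    obtain rfl : A = 1 - A' := by linarith
    rw [e]
    module
  have hbelow : ∀ s, 0 ≤ s → s ≤ s₀ → ‖P + s • (k - P)‖ < a →
      ⟪P + s • (k - P), N⟫_ℝ < (1 + ε) * B (P + s • (k - P)) (P + s • (k - P)) := by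
    intro s hs hss hna
    by_contra hcon
    exact hout s hs hss (hB _ (hna.trans_le haa₂) (not_lt.1 hcon))
  have hxN : 0 ≤ ⟪P + s₀ • (k - P), N⟫_ℝ := by
    rw [inner_add_smul_sub]
    exact add_nonneg (mul_nonneg (by linarith) hPN0) (mul_nonneg hs₀ hkN)
  have hrest : ‖P + s₀ • (k - P)‖ < a → ⟪P + s₀ • (k - P), N⟫_ℝ
      ≤ (1 + η) * B (P + s₀ • (k - P)) (P + s₀ • (k - P)) := fun hna =>
    (hbelow s₀ hs₀ le_rfl hna).le.trans
      (mul_le_mul_of_nonneg_right (by linarith) (h.nonneg _))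
  rcases lt_or_ge ‖k‖ a with hka | hka
  · have hball : ∀ s, 0 ≤ s → s ≤ s₀ → ‖P + s • (k - P)‖ < a := by
      intro s hs hss
      have hb := (convex_ball (0 : E) a) (x := P) (by simpa using hPa) (y := k)
        (by simpa using hka) (by linarith : 0 ≤ 1 - s) hs (by ring)
      rw [mem_ball_zero_iff] at hb
      have e : P + s • (k - P) = (1 - s) • P + s • k := by module
      rwa [e]
    have hγ := h.sq_mul_apply_le hε hε16 hPB hPN (hA k hk (hka.trans_le haa₁)) hs₀ hs₁
      (fun s hs hss => (hbelow s hs hss (hball s hs hss)).le)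
    refine ⟨?_, hxN, hrest (hball s₀ hs₀ le_rfl)⟩
    have hx1 := hbelow s₀ hs₀ le_rfl (hball s₀ hs₀ le_rfl)
    have hx2 := h.apply_add_le P (k - P) s₀
    rw [hPB] at hx2
    have hε48 : 48 * ε * q₀ ≤ 3 * q₀ := by
      linarith [mul_le_mul_of_nonneg_right hε16 hq₀pos.le]
    have hxN16 : ⟪P + s₀ • (k - P), N⟫_ℝ ≤ 16 * q₀ := by nlinarith
    have hB' : B (P + s₀ • (k - P) - r • Y₀) (P + s₀ • (k - P) - r • Y₀)
        = s₀ ^ 2 * B (k - P) (k - P) := by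
      have e : P + s₀ • (k - P) - r • Y₀ = s₀ • (k - P) + ((1 - 2 * ε) * q₀) • N := by
        rw [add_sub_right_comm, add_comm]
        congr 1
        rw [hPdef]; abel
      rw [e, h.apply_add_smul_normal, map_smul, map_smul, LinearMap.smul_apply, smul_eq_mul,
        smul_eq_mul]; ring
    have hN' : ⟪P + s₀ • (k - P) - r • Y₀, N⟫_ℝ = ⟪P + s₀ • (k - P), N⟫_ℝ := by
      rw [inner_sub_left, real_inner_smul_left, hY]; ring
    have h3 := hlow (P + s₀ • (k - P) - r • Y₀)
    rw [hB', hN'] at h3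
    have h4 : ⟪P + s₀ • (k - P), N⟫_ℝ ^ 2 ≤ (16 * q₀) ^ 2 := pow_le_pow_left₀ hxN hxN16 2
    have h5 : (16 * q₀) ^ 2 ≤ m * η ^ 2 / 2 * r ^ 2 := by
      have e : (16 * q₀) ^ 2 = (256 * β₀ ^ 2 * r ^ 2) * r ^ 2 := by rw [hq₀]; ring
      rw [e]
      refine mul_le_mul_of_nonneg_right ?_ (by positivity)
      have := mul_le_mul_of_nonneg_left hrr (show 0 ≤ 256 * β₀ ^ 2 by positivity)
      linarith
    have h6 : 48 * ε * q₀ ≤ m * η ^ 2 / 2 * r ^ 2 := by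
      have := mul_le_mul_of_nonneg_right hεm (sq_nonneg r)
      rw [hq₀]; linarith
    have h7 : m * ‖P + s₀ • (k - P) - r • Y₀‖ ^ 2 ≤ m * (η * r) ^ 2 := by
      rw [mul_pow]; linarith
    exact le_of_sq_le_sq (le_of_mul_le_mul_left h7 hm) (by positivity)
  · have hκk := hfar k hk hka
    have hkP : ‖k - P‖ ≤ D + 1 := (norm_sub_le _ _).trans (by linarith [hCD k hk])
    have hnorm : ∀ s, 0 ≤ s → s ≤ l * r → ‖P + s • (k - P)‖ ≤ (c + η) * r := by
      intro s hs hsl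
      refine (norm_add_le _ _).trans ?_
      rw [norm_smul, Real.norm_eq_abs, abs_of_nonneg hs]
      have : s * ‖k - P‖ ≤ l * r * (D + 1) :=
        mul_le_mul hsl hkP (norm_nonneg _) (by positivity)
      have e : l * r * (D + 1) = η / 2 * r := by rw [← hlD]; ring
      linarith [mul_pos hη hr]
    have hsl : s₀ ≤ l * r := by
      by_contra hcon
      have hlr : 0 < l * r := by positivity
      have h1 := hnorm (l * r) hlr.le le_rfl
      have h2 := hbelow (l * r) hlr.le (not_le.1 hcon).le (h1.trans_lt hcηa)
      have h3 := hup (P + (l * r) • (k - P))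
      have h4 : ‖P + (l * r) • (k - P)‖ ^ 2 ≤ ((c + η) * r) ^ 2 :=
        pow_le_pow_left₀ (norm_nonneg _) h1 2
      have h5 := mul_le_mul_of_nonneg_left h4 hM.le
      have h6 := h.nonneg (P + (l * r) • (k - P))
      have h7 : l * r * κ ≤ ⟪P + (l * r) • (k - P), N⟫_ℝ := by
        rw [inner_add_smul_sub]
        have : 0 ≤ (1 - l * r) * ⟪P, N⟫_ℝ := mul_nonneg (by linarith [not_le.1 hcon]) hPN0
        have := mul_le_mul_of_nonneg_left hκk hlr.le
        linarith
      have h8 : l * r * κ < 2 * (M * ((c + η) * r) ^ 2) := by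
        linarith [mul_nonneg (show 0 ≤ 1 - ε by linarith) h6]
      have h9 := mul_lt_mul_of_pos_right hMr hr
      linarith
    refine ⟨?_, hxN, hrest ((hnorm s₀ hs₀ hsl).trans_lt hcηa)⟩
    calc ‖P + s₀ • (k - P) - r • Y₀‖ = ‖(P - r • Y₀) + s₀ • (k - P)‖ := by congr 1; abel
      _ ≤ ‖P - r • Y₀‖ + ‖s₀ • (k - P)‖ := norm_add_le _ _
      _ ≤ β₀ * r ^ 2 + l * r * (D + 1) := by
        rw [norm_smul, Real.norm_eq_abs, abs_of_nonneg hs₀]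
        exact add_le_add hPr (mul_le_mul hsl hkP (norm_nonneg _) (by positivity))
      _ ≤ η * r := by
        have e : l * r * (D + 1) = η / 2 * r := by rw [← hlD]; ring
        linarith [mul_lt_mul_of_pos_right hβη hr]

end Osculates

/-! ### Thin slabs -/

lemma volume_inner_eq_zero {n : ℕ} {N : EuclideanSpace ℝ (Fin n)} (hN : ‖N‖ = 1) :
    volume {z : EuclideanSpace ℝ (Fin n) | ⟪z, N⟫_ℝ = 0} = 0 := by
  have hne : (ℝ ∙ N)ᗮ ≠ ⊤ := by
    intro h
    have : N ∈ (ℝ ∙ N)ᗮ := h ▸ Submodule.mem_top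
    rw [Submodule.mem_orthogonal_singleton_iff_inner_left, real_inner_self_eq_norm_sq, hN] at this
    norm_num at this
  convert Measure.addHaar_submodule volume _ hne using 2
  ext z
  simp [Submodule.mem_orthogonal_singleton_iff_inner_left]

lemma tendsto_volume_slab {n : ℕ} {N : EuclideanSpace ℝ (Fin n)} (hN : ‖N‖ = 1) (c : ℝ) :
    Tendsto (fun r : ℝ => volume {z : EuclideanSpace ℝ (Fin n) | ‖z‖ ≤ c ∧ 0 ≤ ⟪z, N⟫_ℝ ∧
      ⟪z, N⟫_ℝ ≤ r}) (𝓝[>] 0) (𝓝 0) := by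
  have hclosed : ∀ r : ℝ, IsClosed {z : EuclideanSpace ℝ (Fin n) | ‖z‖ ≤ c ∧ 0 ≤ ⟪z, N⟫_ℝ ∧
      ⟪z, N⟫_ℝ ≤ r} := fun r => by
    have hc : Continuous fun z : EuclideanSpace ℝ (Fin n) => ⟪z, N⟫_ℝ := by fun_prop
    exact (isClosed_le continuous_norm continuous_const).inter
      ((isClosed_le continuous_const hc).inter (isClosed_le hc continuous_const))
  have h := tendsto_measure_biInter_gt (μ := (volume : Measure (EuclideanSpace ℝ (Fin n))))
    (s := fun r : ℝ => {z : EuclideanSpace ℝ (Fin n) | ‖z‖ ≤ c ∧ 0 ≤ ⟪z, N⟫_ℝ ∧ ⟪z, N⟫_ℝ ≤ r})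
    (a := 0) (fun r _ => (hclosed r).measurableSet.nullMeasurableSet)
    (fun i j _ hij z hz => ⟨hz.1, hz.2.1, hz.2.2.trans hij⟩)
    ⟨1, one_pos, ((measure_mono (fun z hz => by simpa using hz.1)).trans_lt
      (measure_closedBall_lt_top (x := (0 : EuclideanSpace ℝ (Fin n))) (r := c))).ne⟩
  rwa [measure_mono_null (fun z hz => ?_) (volume_inner_eq_zero hN)] at h
  simp only [mem_iInter, mem_ofPred_eq] at hz ⊢
  refine le_antisymm (le_of_forall_pos_le_add fun r hr => ?_) (hz 1 one_pos).2.1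
  simpa using (hz r hr).2.2

open scoped Pointwise in
lemma eventually_volume_slab_le {n : ℕ} (hn : 2 ≤ n) {N : EuclideanSpace ℝ (Fin n)}
    (hN : ‖N‖ = 1) {c : ℝ} (hc : 0 < c) {δ : ℝ} (hδ : 0 < δ) :
    ∀ᶠ r in 𝓝[>] (0 : ℝ), (volume {z : EuclideanSpace ℝ (Fin n) | ‖z‖ ≤ c * r ∧ 0 ≤ ⟪z, N⟫_ℝ ∧
      ⟪z, N⟫_ℝ ≤ c * r ^ 2}).toReal ≤ δ * r ^ 2 := by
  have hlim : Tendsto (fun r : ℝ => c * r) (𝓝[>] 0) (𝓝[>] 0) := by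
    refine tendsto_nhdsWithin_of_tendsto_nhds_of_eventually_within _ ?_ ?_
    · have : Tendsto (fun r : ℝ => c * r) (𝓝 0) (𝓝 (c * 0)) := tendsto_id.const_mul c
      rw [mul_zero] at this
      exact this.mono_left nhdsWithin_le_nhds
    · filter_upwards [eventually_pos_nhdsGT] with r hr using mul_pos hc hr
  have h := ((tendsto_volume_slab hN c).comp hlim).eventually_lt_const
    (ENNReal.ofReal_pos.2 hδ)
  filter_upwards [h, eventually_pos_nhdsGT, eventually_mul_lt 1 one_pos] with r hv hr hr1
  have e : {z : EuclideanSpace ℝ (Fin n) | ‖z‖ ≤ c * r ∧ 0 ≤ ⟪z, N⟫_ℝ ∧ ⟪z, N⟫_ℝ ≤ c * r ^ 2}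
      = r • {z : EuclideanSpace ℝ (Fin n) | ‖z‖ ≤ c ∧ 0 ≤ ⟪z, N⟫_ℝ ∧ ⟪z, N⟫_ℝ ≤ c * r} := by
    ext z
    rw [Set.mem_smul_set_iff_inv_smul_mem₀ hr.ne']
    simp only [mem_ofPred_eq, norm_smul, real_inner_smul_left, norm_inv, Real.norm_eq_abs,
      abs_of_pos hr]
    rw [inv_mul_le_iff₀ hr, inv_mul_le_iff₀ hr, mul_comm c r]
    refine and_congr_right fun _ => and_congr ?_ ?_
    · rw [mul_nonneg_iff_of_pos_left (inv_pos.2 hr)]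
    · rw [show r * (r * c) = c * r ^ 2 by ring]
  rw [e, Measure.addHaar_smul, finrank_euclideanSpace_fin, ENNReal.toReal_mul,
    ENNReal.toReal_ofReal (abs_nonneg _), abs_of_pos (pow_pos hr n)]
  have h1 : (volume {z : EuclideanSpace ℝ (Fin n) | ‖z‖ ≤ c ∧ 0 ≤ ⟪z, N⟫_ℝ ∧
      ⟪z, N⟫_ℝ ≤ c * r}).toReal ≤ δ := ENNReal.toReal_le_of_le_ofReal hδ.le hv.le
  rw [mul_comm]
  exact mul_le_mul h1 (pow_le_pow_of_le_one hr.le (by linarith) hn) (by positivity) hδ.le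

/-! ### Adding a pair of bumps -/

lemma isCompact_convexJoin {E : Type*} [AddCommGroup E] [Module ℝ E] [TopologicalSpace E]
    [ContinuousAdd E] [ContinuousSMul ℝ E] {s t : Set E} (hs : IsCompact s) (ht : IsCompact t) :
    IsCompact (convexJoin ℝ s t) := by
  have e : convexJoin ℝ s t
      = (fun q : ℝ × E × E => (1 - q.1) • q.2.1 + q.1 • q.2.2) '' (Icc (0 : ℝ) 1 ×ˢ s ×ˢ t) := by
    ext x
    simp only [mem_convexJoin, segment_eq_image, mem_image, Set.mem_prod, Prod.exists]
    constructor
    · rintro ⟨a, ha, b, hb, θ, hθ, rfl⟩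
      exact ⟨θ, a, b, ⟨hθ, ha, hb⟩, rfl⟩
    · rintro ⟨θ, a, b, ⟨hθ, ha, hb⟩, rfl⟩
      exact ⟨a, ha, b, hb, θ, hθ, rfl⟩
  rw [e]
  exact (isCompact_Icc.prod (hs.prod ht)).image (by fun_prop)

lemma neg_mem_convexJoin {E : Type*} [AddCommGroup E] [Module ℝ E] {s t : Set E}
    (hs : ∀ x ∈ s, -x ∈ s) (ht : ∀ x ∈ t, -x ∈ t) {x : E} (hx : x ∈ convexJoin ℝ s t) :
    -x ∈ convexJoin ℝ s t := by
  rw [mem_convexJoin] at hx ⊢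
  obtain ⟨a, ha, b, hb, α, β, h1, h2, h3, rfl⟩ := hx
  exact ⟨-a, hs a ha, -b, ht b hb, α, β, h1, h2, h3, by module⟩

lemma eq_neg_of_forall_neg_mem {E : Type*} [AddCommGroup E] {s : Set E} (h : ∀ x ∈ s, -x ∈ s) :
    s = -s := by
  ext x
  rw [Set.mem_neg]
  exact ⟨h x, fun hx => by simpa using h _ hx⟩

lemma forall_neg_mem_of_eq_neg {E : Type*} [AddCommGroup E] {s : Set E} (h : s = -s) :
    ∀ x ∈ s, -x ∈ s := fun x hx => by
  rw [h] at hx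
  exact hx

/-- Up to sign, every point of the join of a symmetric body with `[-P, P]` lies on a segment from
`P` to the body. -/
lemma exists_segment_of_mem_convexJoin {E : Type*} [AddCommGroup E] [Module ℝ E] {K : Set E}
    (hK : Convex ℝ K) (h0 : (0 : E) ∈ K) (hs : ∀ x ∈ K, -x ∈ K) {P x : E}
    (hx : x ∈ convexJoin ℝ K (segment ℝ (-P) P)) :
    ∃ k ∈ K, ∃ s : ℝ, 0 ≤ s ∧ s ≤ 1 ∧ (x = P + s • (k - P) ∨ -x = P + s • (k - P)) := by
  have key : ∀ k ∈ K, ∀ τ b : ℝ, 0 ≤ τ → τ ≤ 1 → 0 ≤ b → b ≤ 1 →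
      ∃ k' ∈ K, ∃ s : ℝ, 0 ≤ s ∧ s ≤ 1 ∧ (1 - b) • k + (b * τ) • P = P + s • (k' - P) := by
    intro k hk τ b hτ hτ1 hb hb1
    have hbτ : b * τ ≤ b := by nlinarith
    have hbτ0 : 0 ≤ b * τ := mul_nonneg hb hτ
    rcases (show 0 ≤ 1 - b * τ by linarith).eq_or_lt with h | h
    · have hb' : b = 1 := by linarith
      refine ⟨k, hk, 0, le_rfl, zero_le_one, ?_⟩
      rw [show b * τ = 1 by linarith, hb']
      simp
    · refine ⟨((1 - b) / (1 - b * τ)) • k,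
        hK.smul_mem_of_zero_mem h0 hk ⟨div_nonneg (by linarith) h.le, (div_le_one h).2 (by linarith)⟩,
        1 - b * τ, h.le, by linarith, ?_⟩
      rw [smul_sub, smul_smul, mul_div_cancel₀ _ h.ne']
      module
  rw [mem_convexJoin] at hx
  obtain ⟨k, hk, y, ⟨α, β, hα, hβ, hαβ, rfl⟩, a, b, ha, hb, hab, rfl⟩ := hx
  obtain rfl : a = 1 - b := by linarith
  obtain rfl : α = 1 - β := by linarith
  rcases le_total (1 / 2) β with h | h
  · obtain ⟨k', hk', s, hs0, hs1, he⟩ := key k hk (2 * β - 1) b (by linarith) (by linarith) hb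
      (by linarith)
    exact ⟨k', hk', s, hs0, hs1, Or.inl (by rw [← he]; module)⟩
  · obtain ⟨k', hk', s, hs0, hs1, he⟩ := key (-k) (hs k hk) (1 - 2 * β) b (by linarith)
      (by linarith) hb (by linarith)
    exact ⟨k', hk', s, hs0, hs1, Or.inr (by rw [← he]; module)⟩

lemma isoDensity_neg {n : ℕ} (K : Set (EuclideanSpace ℝ (Fin n))) (x : EuclideanSpace ℝ (Fin n)) :
    isoDensity K (-x) = isoDensity K x := by
  simp [isoDensity]

lemma zero_mem_interior_of_symm {E : Type*} [NormedAddCommGroup E] [NormedSpace ℝ E] {K : Set E}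
    (hK : Convex ℝ K) (hs : ∀ x ∈ K, -x ∈ K) (hi : (interior K).Nonempty) :
    (0 : E) ∈ interior K := by
  obtain ⟨x, hx⟩ := hi
  have := hK.combo_interior_self_mem_interior hx (hs x (interior_subset hx))
    (a := 1 / 2) (b := 1 / 2) (by norm_num) (by norm_num) (by norm_num)
  simpa using this

lemma IsConvexBody.volume_pos {n : ℕ} {K : Set (EuclideanSpace ℝ (Fin n))} (hK : IsConvexBody K) :
    0 < (volume K).toReal :=
  ENNReal.toReal_pos (Measure.measure_pos_of_nonempty_interior _ hK.2.2).ne' hK.1.measure_lt_top.ne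

/-- A nonempty relatively open piece of a convex body has positive volume. -/
lemma IsConvexBody.volume_inter_pos {n : ℕ} {K U : Set (EuclideanSpace ℝ (Fin n))}
    (hK : IsConvexBody K) (hU : IsOpen U) {x : EuclideanSpace ℝ (Fin n)} (hx : x ∈ K)
    (hxU : x ∈ U) : 0 < (volume (K ∩ U)).toReal := by
  refine ENNReal.toReal_pos (Measure.measure_pos_of_nonempty_interior _ ?_).ne'
    ((measure_mono inter_subset_left).trans_lt hK.1.measure_lt_top).ne
  rw [interior_inter, hU.interior_eq]
  have hcl : x ∈ closure (interior K) := by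
    rw [hK.2.1.closure_interior_eq_closure_of_nonempty_interior hK.2.2]
    exact subset_closure hx
  obtain ⟨y, hyU, hy⟩ := mem_closure_iff.1 hcl U hU hxU
  exact ⟨y, hy, hyU⟩

/-- Volume of a set contained in a translate of `S` and its reflection. -/
lemma volume_toReal_le_of_symm {n : ℕ} {D S : Set (EuclideanSpace ℝ (Fin n))}
    {X₀ : EuclideanSpace ℝ (Fin n)} {v : ℝ} (hS : volume S ≠ ⊤) (hv : (volume S).toReal ≤ v)
    (h : ∀ x ∈ D, x - X₀ ∈ S ∨ -x - X₀ ∈ S) : (volume D).toReal ≤ 2 * v := by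
  have h1 : volume ((fun x => x - X₀) ⁻¹' S) = volume S := by
    simp [sub_eq_add_neg]
  have h2 : volume ((fun x => -x - X₀) ⁻¹' S) = volume S := by
    rw [← h1, ← Measure.measure_preimage_neg volume ((fun x => x - X₀) ⁻¹' S)]
    rfl
  have h3 : volume D ≤ volume S + volume S := by
    refine (measure_mono (show D ⊆ ((fun x => x - X₀) ⁻¹' S) ∪ ((fun x => -x - X₀) ⁻¹' S)
      from h)).trans ((measure_union_le _ _).trans ?_)
    rw [h1, h2]
  have h4 := ENNReal.toReal_mono (ENNReal.add_ne_top.2 ⟨hS, hS⟩) h3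
  rw [ENNReal.toReal_add hS hS] at h4
  linarith

lemma volume_slab_ne_top {n : ℕ} (N : EuclideanSpace ℝ (Fin n)) (c d : ℝ) :
    volume {z : EuclideanSpace ℝ (Fin n) | ‖z‖ ≤ c ∧ 0 ≤ ⟪z, N⟫_ℝ ∧ ⟪z, N⟫_ℝ ≤ d} ≠ ⊤ :=
  ((measure_mono (fun z hz => by simpa using hz.1)).trans_lt
    (measure_closedBall_lt_top (x := (0 : EuclideanSpace ℝ (Fin n))) (r := c))).ne

/-- If the density is at least of order `r²` on bumps below the graph, adding such bumps increases
the isotropy constant. -/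
lemma exists_isoL_lt_of_le_isoDensity {n : ℕ} (hn : 2 ≤ n) {K : Set (EuclideanSpace ℝ (Fin n))}
    (hK : IsConvexBody K) (hsym : K = -K) {X₀ N : EuclideanSpace ℝ (Fin n)}
    {B : EuclideanSpace ℝ (Fin n) →ₗ[ℝ] EuclideanSpace ℝ (Fin n) →ₗ[ℝ] ℝ}
    (h : Osculates {z | X₀ + z ∈ K} N B) {Y₀ : EuclideanSpace ℝ (Fin n)} (hY : ⟪Y₀, N⟫_ℝ = 0)
    (hY0 : Y₀ ≠ 0) {η c : ℝ} (hη : 0 < η) (hc : 0 < c)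
    (hdens : ∀ᶠ r in 𝓝[>] (0 : ℝ), ∀ x, ‖x - r • Y₀‖ ≤ η * r → 0 ≤ ⟪x, N⟫_ℝ →
      ⟪x, N⟫_ℝ ≤ (1 + η) * B x x → c * r ^ 2 ≤ isoDensity K (X₀ + x))
    {ε : ℝ} (hε : 0 < ε) :
    ∃ K' : Set (EuclideanSpace ℝ (Fin n)),
      IsConvexBody K' ∧ K' = -K' ∧ hausdorffDist K' K < ε ∧ isoL n K < isoL n K' := by
  have hKs := forall_neg_mem_of_eq_neg hsym
  have h0 : (0 : EuclideanSpace ℝ (Fin n)) ∈ K :=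
    interior_subset (zero_mem_interior_of_symm hK.2.1 hKs hK.2.2)
  have hX₀ : X₀ ∈ K := by simpa using h.zero_mem
  obtain ⟨M, hM, hup⟩ := h.upper
  set v := (volume K).toReal with hv
  have hvpos : 0 < v := hK.volume_pos
  set A : ℝ := 4 ^ (n + 2) / v ^ 2 with hA
  have hApos : 0 < A := by positivity
  set d := ‖Y₀‖ + η with hd
  have hdpos : 0 < d := by positivity
  set e := max d ((1 + η) * (M * d ^ 2)) with he
  have hepos : 0 < e := lt_max_of_lt_left hdpos
  set δ := min (c / (4 * A)) (v / 2) with hδ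
  have hδpos : 0 < δ := by positivity
  have hδA : 2 * A * δ < c := by
    have : δ ≤ c / (4 * A) := min_le_left _ _
    rw [le_div_iff₀ (by positivity)] at this
    linarith
  have hδv : 2 * δ ≤ v := by
    have : δ ≤ v / 2 := min_le_right _ _
    linarith
  obtain ⟨r, hr, hr1, hrε, hvol, hbump, P, hPC, hP⟩ := (eventually_pos_nhdsGT.and
    ((eventually_mul_lt 1 one_pos).and ((eventually_mul_lt d (half_pos hε)).and
      ((eventually_volume_slab_le hn h.norm_eq_one hepos hδpos).and
        (hdens.and (h.exists_notMem_forall_segment hY hY0 hη)))))).exists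
  set P' := X₀ + P with hP'
  have hP'K : P' ∉ K := hPC
  set K' := convexJoin ℝ K (segment ℝ (-P') P') with hK'
  have hsub : K ⊆ K' := by
    rw [hK']
    exact subset_convexJoin_left ⟨P', right_mem_segment ℝ _ _⟩
  have hP'mem : P' ∈ K' := by
    rw [hK']
    exact subset_convexJoin_right ⟨0, h0⟩ (right_mem_segment ℝ _ _)
  have hsegneg : ∀ x ∈ segment ℝ (-P') P', -x ∈ segment ℝ (-P') P' := by
    rintro x ⟨a, b, ha, hb, hab, rfl⟩
    exact ⟨b, a, hb, ha, by rw [add_comm]; exact hab, by module⟩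
  have hsegc : IsCompact (segment ℝ (-P') P') := by
    rw [segment_eq_image]
    exact isCompact_Icc.image (by fun_prop)
  have hbody : IsConvexBody K' :=
    ⟨isCompact_convexJoin hK.1 hsegc, hK.2.1.convexJoin (convex_segment _ _),
      hK.2.2.mono (interior_mono hsub)⟩
  have hsym' : K' = -K' := eq_neg_of_forall_neg_mem fun x hx => neg_mem_convexJoin hKs hsegneg hx
  have hD : ∀ x ∈ K' \ K, ∃ z, (x = X₀ + z ∨ -x = X₀ + z) ∧ ‖z - r • Y₀‖ ≤ η * r ∧ 0 ≤ ⟪z, N⟫_ℝ ∧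
      ⟪z, N⟫_ℝ ≤ (1 + η) * B z z := by
    rintro x ⟨hx, hxK⟩
    obtain ⟨k, hk, s, hs0, hs1, hxs⟩ := exists_segment_of_mem_convexJoin hK.2.1 h0 hKs hx
    have eq : P' + s • (k - P') = X₀ + (P + s • ((k - X₀) - P)) := by
      rw [hP']; module
    rw [eq] at hxs
    refine ⟨_, hxs, hP (k - X₀) (by simpa using hk) s hs0 hs1 fun hmem => hxK ?_⟩
    have hmem' : X₀ + (P + s • ((k - X₀) - P)) ∈ K := hmem
    rcases hxs with hxs | hxs
    · rwa [hxs]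
    · have := hKs _ hmem'
      rwa [← hxs, neg_neg] at this
  have hnorm : ∀ z : EuclideanSpace ℝ (Fin n), ‖z - r • Y₀‖ ≤ η * r → ‖z‖ ≤ d * r := by
    intro z hz
    have h1 : ‖z‖ ≤ ‖z - r • Y₀‖ + ‖r • Y₀‖ := by
      simpa using norm_add_le (z - r • Y₀) (r • Y₀)
    rw [norm_smul, Real.norm_eq_abs, abs_of_pos hr] at h1
    rw [hd]; linarith
  have hVle : (volume (K' \ K)).toReal ≤ 2 * (δ * r ^ 2) := by
    refine volume_toReal_le_of_symm (X₀ := X₀) (volume_slab_ne_top N (e * r) (e * r ^ 2)) hvol ?_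
    intro x hx
    obtain ⟨z, hxz, hz1, hz2, hz3⟩ := hD x hx
    have hzS : z ∈ {z : EuclideanSpace ℝ (Fin n) | ‖z‖ ≤ e * r ∧ 0 ≤ ⟪z, N⟫_ℝ ∧
        ⟪z, N⟫_ℝ ≤ e * r ^ 2} := by
      have hz4 := hnorm z hz1
      refine ⟨hz4.trans (mul_le_mul_of_nonneg_right (le_max_left _ _) hr.le), hz2, ?_⟩
      calc ⟪z, N⟫_ℝ ≤ (1 + η) * (M * ‖z‖ ^ 2) :=
            hz3.trans (mul_le_mul_of_nonneg_left (hup z) (by linarith))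
        _ ≤ (1 + η) * (M * (d * r) ^ 2) := by gcongr
        _ = (1 + η) * (M * d ^ 2) * r ^ 2 := by ring
        _ ≤ e * r ^ 2 := mul_le_mul_of_nonneg_right (le_max_right _ _) (sq_nonneg r)
    rcases hxz with hxz | hxz
    · left; rw [hxz]; simpa using hzS
    · right; rw [hxz]; simpa using hzS
  have hVpos : 0 < (volume (K' \ K)).toReal :=
    hbody.volume_inter_pos hK.1.isClosed.isOpen_compl hP'mem hP'K
  have hrr : r ^ 2 ≤ 1 := by nlinarith
  refine ⟨K', hbody, hsym', ?_, ?_⟩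
  · refine lt_of_le_of_lt (hausdorffDist_le_of_mem_dist (r := ε / 2) (half_pos hε).le ?_ ?_)
      (half_lt_self hε)
    · intro x hx
      by_cases hxK : x ∈ K
      · exact ⟨x, hxK, by simpa using (half_pos hε).le⟩
      obtain ⟨z, hxz, hz1, -, -⟩ := hD x ⟨hx, hxK⟩
      have hz4 := (hnorm z hz1).trans hrε.le
      rcases hxz with hxz | hxz
      · exact ⟨X₀, hX₀, by rw [hxz, dist_eq_norm]; simpa using hz4⟩
      · refine ⟨-X₀, hKs _ hX₀, ?_⟩
        rw [← dist_neg_neg, hxz, neg_neg, dist_eq_norm]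
        simpa using hz4
    · intro x hx
      exact ⟨x, hsub hx, by simpa using (half_pos hε).le⟩
  · refine isoL_lt_isoL_of_superset (by omega) hK.1 hbody.1 hsym hsym' hvpos hsub ?_ ?_
    · nlinarith
    · have hlow : c * r ^ 2 * (volume (K' \ K)).toReal ≤ ∫ x in K' \ K, isoDensity K x := by
        have hfin : volume (K' \ K) ≠ ⊤ :=
          ((measure_mono sdiff_subset).trans_lt hbody.1.measure_lt_top).ne
        have hconst : c * r ^ 2 * (volume (K' \ K)).toReal = ∫ _ in K' \ K, c * r ^ 2 := by
          rw [setIntegral_const, smul_eq_mul, mul_comm, Measure.real]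
        rw [hconst]
        refine setIntegral_mono_on (integrableOn_const hfin)
          (integrableOn_of_continuous hbody.1 sdiff_subset (continuous_isoDensity K))
          (hbody.1.measurableSet.diff hK.1.measurableSet) fun x hx => ?_
        obtain ⟨z, hxz, hz1, hz2, hz3⟩ := hD x hx
        have := hbump z hz1 hz2 hz3
        rcases hxz with hxz | hxz
        · rwa [hxz]
        · rwa [← isoDensity_neg, hxz]
      refine lt_of_lt_of_le ?_ hlow
      set V := (volume (K' \ K)).toReal
      have h1 : A * V ≤ 2 * A * δ * r ^ 2 := by
        have := mul_le_mul_of_nonneg_left hVle hApos.le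
        linarith
      have h2 : 2 * A * δ * r ^ 2 < c * r ^ 2 := mul_lt_mul_of_pos_right hδA (by positivity)
      have h3 : A * V < c * r ^ 2 := by linarith
      calc A * V ^ 2 = A * V * V := by ring
        _ < c * r ^ 2 * V := mul_lt_mul_of_pos_right h3 hVpos

/-! ### Cutting off a pair of caps -/

lemma setIntegral_preimage_add_left {n : ℕ} (X₀ : EuclideanSpace ℝ (Fin n))
    (f : EuclideanSpace ℝ (Fin n) → ℝ) (S : Set (EuclideanSpace ℝ (Fin n))) :
    ∫ z in {z | X₀ + z ∈ S}, f (X₀ + z) = ∫ x in S, f x :=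
  (measurePreserving_add_left volume X₀).setIntegral_preimage_emb
    (MeasurableEquiv.addLeft X₀).measurableEmbedding f S

lemma setIntegral_preimage_neg {n : ℕ} (f : EuclideanSpace ℝ (Fin n) → ℝ)
    (S : Set (EuclideanSpace ℝ (Fin n))) :
    ∫ z in {z | -z ∈ S}, f (-z) = ∫ x in S, f x :=
  (Measure.measurePreserving_neg volume).setIntegral_preimage_emb
    (MeasurableEquiv.neg _).measurableEmbedding f S

lemma inner_lt_zero_of_supporting {n : ℕ} {K : Set (EuclideanSpace ℝ (Fin n))}
    (h0 : (0 : EuclideanSpace ℝ (Fin n)) ∈ interior K) {X₀ N : EuclideanSpace ℝ (Fin n)}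
    (hN : ‖N‖ = 1) (h : ∀ x ∈ K, 0 ≤ ⟪x - X₀, N⟫_ℝ) : ⟪X₀, N⟫_ℝ < 0 := by
  obtain ⟨t, ht, hball⟩ := Metric.isOpen_iff.1 isOpen_interior 0 h0
  have hmem : (-(t / 2)) • N ∈ K := by
    refine interior_subset (hball ?_)
    rw [mem_ball_zero_iff, norm_smul, hN, norm_neg, Real.norm_eq_abs, abs_of_pos (half_pos ht)]
    linarith
  have := h _ hmem
  rw [inner_sub_left, real_inner_smul_left, real_inner_self_eq_norm_sq, hN] at this
  linarith

/-- If the density has average at most of order `-r²` on caps of height `r²`, cutting off such caps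
increases the isotropy constant. -/
lemma exists_isoL_lt_of_setIntegral_isoDensity_le {n : ℕ} (hn : 2 ≤ n)
    {K : Set (EuclideanSpace ℝ (Fin n))} (hK : IsConvexBody K) (hsym : K = -K)
    {X₀ N : EuclideanSpace ℝ (Fin n)}
    {B : EuclideanSpace ℝ (Fin n) →ₗ[ℝ] EuclideanSpace ℝ (Fin n) →ₗ[ℝ] ℝ}
    (h : Osculates {z | X₀ + z ∈ K} N B) {c : ℝ} (hc : 0 < c)
    (hdens : ∀ᶠ r in 𝓝[>] (0 : ℝ),
      ∫ z in {z | X₀ + z ∈ K ∧ ⟪z, N⟫_ℝ < r ^ 2}, isoDensity K (X₀ + z)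
        ≤ -(c * r ^ 2 * (volume {z | X₀ + z ∈ K ∧ ⟪z, N⟫_ℝ < r ^ 2}).toReal))
    {ε : ℝ} (hε : 0 < ε) :
    ∃ K' : Set (EuclideanSpace ℝ (Fin n)),
      IsConvexBody K' ∧ K' = -K' ∧ hausdorffDist K' K < ε ∧ isoL n K < isoL n K' := by
  have hKs := forall_neg_mem_of_eq_neg hsym
  have h0 := zero_mem_interior_of_symm hK.2.1 hKs hK.2.2
  have hX₀ : X₀ ∈ K := by simpa using h.zero_mem
  have hsupp : ∀ x ∈ K, 0 ≤ ⟪x - X₀, N⟫_ℝ := fun x hx => h.inner_nonneg _ (by simpa using hx)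
  obtain ⟨σ, hσ⟩ : ∃ σ, σ = -⟪X₀, N⟫_ℝ := ⟨_, rfl⟩
  have hσpos : 0 < σ := by
    have := inner_lt_zero_of_supporting h0 h.norm_eq_one hsupp
    linarith
  have hXN : ⟪X₀, N⟫_ℝ = -σ := by linarith
  obtain ⟨d, hd, hcap⟩ := h.exists_norm_le_of_inner_lt
  set v := (volume K).toReal with hv
  have hvpos : 0 < v := hK.volume_pos
  set A : ℝ := 4 ^ (n + 2) / v ^ 2 with hA
  have hApos : 0 < A := by positivity
  set e := max d 1 with he
  have hepos : 0 < e := lt_max_of_lt_left hd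
  set δ := c / (4 * A) with hδ
  have hδpos : 0 < δ := by positivity
  have hδA : 2 * A * δ < c := by
    have : 4 * A * δ = c := by rw [hδ]; field_simp
    linarith
  obtain ⟨r, hr, hr1, hrσ, hrd, hrX, hvol, hintg, hcapr⟩ := (eventually_pos_nhdsGT.and
    ((eventually_mul_lt 1 one_pos).and ((eventually_mul_lt 1 hσpos).and
      ((eventually_mul_lt d (half_pos hε)).and ((eventually_mul_lt (‖X₀‖ / σ) (half_pos hε)).and
      ((eventually_volume_slab_le hn h.norm_eq_one hepos hδpos).and
        (hdens.and hcap))))))).exists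
  have hrr : r ^ 2 ≤ r := by nlinarith
  have hσr : 0 < σ - r ^ 2 := by linarith
  have hcont : Continuous fun x : EuclideanSpace ℝ (Fin n) => ⟪x, N⟫_ℝ := by fun_prop
  set U : Set (EuclideanSpace ℝ (Fin n)) := {x | ⟪x, N⟫_ℝ < -(σ - r ^ 2)} with hU
  have hUo : IsOpen U := isOpen_lt hcont continuous_const
  set D := K ∩ U with hD
  have hDm : MeasurableSet D := hK.1.measurableSet.inter hUo.measurableSet
  have hDcap : {z | X₀ + z ∈ K ∧ ⟪z, N⟫_ℝ < r ^ 2} = {z | X₀ + z ∈ D} := by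
    ext z
    simp only [mem_ofPred_eq, hD, hU, Set.mem_inter_iff, inner_add_left, hXN]
    refine and_congr_right fun _ => ?_
    constructor <;> intro hz <;> linarith
  rw [hDcap, setIntegral_preimage_add_left X₀ (isoDensity K) D] at hintg
  have hvD : volume {z | X₀ + z ∈ D} = volume D := measure_preimage_add volume X₀ D
  rw [hvD] at hintg
  have hDfin : volume D ≠ ⊤ := ((measure_mono inter_subset_left).trans_lt hK.1.measure_lt_top).ne
  have hDpos : 0 < (volume D).toReal := by
    refine hK.volume_inter_pos hUo hX₀ ?_
    simp only [hU, mem_ofPred_eq, hXN]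
    nlinarith
  have hDle : (volume D).toReal ≤ δ * r ^ 2 := by
    refine le_trans (ENNReal.toReal_mono (volume_slab_ne_top N (e * r) (e * r ^ 2)) ?_) hvol
    rw [← hvD]
    refine measure_mono fun z hz => ?_
    have hz' : X₀ + z ∈ K ∧ ⟪z, N⟫_ℝ < r ^ 2 := by rw [← hDcap] at hz; exact hz
    refine ⟨(hcapr z hz'.1 hz'.2).trans (mul_le_mul_of_nonneg_right (le_max_left _ _) hr.le),
      h.inner_nonneg z hz'.1, hz'.2.le.trans ?_⟩
    have := mul_le_mul_of_nonneg_right (le_max_right d 1) (sq_nonneg r)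
    linarith
  set K' := K ∩ {x | |⟪x, N⟫_ℝ| ≤ σ - r ^ 2} with hK'
  have hsub : K' ⊆ K := inter_subset_left
  have hK'c : IsCompact K' := hK.1.inter_right (isClosed_le hcont.abs continuous_const)
  have hslab : {x : EuclideanSpace ℝ (Fin n) | |⟪x, N⟫_ℝ| ≤ σ - r ^ 2}
      = {x | -(σ - r ^ 2) ≤ ⟪x, N⟫_ℝ} ∩ {x | ⟪x, N⟫_ℝ ≤ σ - r ^ 2} := by
    ext x
    simp only [mem_ofPred_eq, Set.mem_inter_iff, abs_le]
  have hlin : IsLinearMap ℝ fun x : EuclideanSpace ℝ (Fin n) => ⟪x, N⟫_ℝ :=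
    ⟨fun x y => inner_add_left x y N, fun a x => by simp [real_inner_smul_left]⟩
  have hbody : IsConvexBody K' := by
    refine ⟨hK'c, ?_, ⟨0, ?_⟩⟩
    · rw [hK', hslab]
      exact hK.2.1.inter ((convex_halfSpace_ge hlin _).inter (convex_halfSpace_le hlin _))
    · rw [hK', interior_inter]
      refine ⟨h0, interior_maximal (s := {x | |⟪x, N⟫_ℝ| ≤ σ - r ^ 2})
        (t := {x | |⟪x, N⟫_ℝ| < σ - r ^ 2}) (fun x (hx : |⟪x, N⟫_ℝ| < σ - r ^ 2) => hx.le)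
        (isOpen_lt hcont.abs continuous_const) ?_⟩
      simpa using hσr
  have hsym' : K' = -K' := eq_neg_of_forall_neg_mem fun x hx =>
    ⟨hKs x hx.1, by simpa [inner_neg_left, abs_neg] using hx.2⟩
  have hdiff : K \ K' = D ∪ {x | -x ∈ D} := by
    ext x
    simp only [hK', hD, hU, Set.mem_sdiff, Set.mem_union, Set.mem_inter_iff, mem_ofPred_eq,
      inner_neg_left]
    constructor
    · rintro ⟨hx, hx'⟩
      have h2 : σ - r ^ 2 < |⟪x, N⟫_ℝ| := not_le.1 fun hle => hx' ⟨hx, hle⟩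
      rcases lt_abs.1 h2 with h3 | h3
      · exact Or.inr ⟨hKs x hx, by linarith⟩
      · exact Or.inl ⟨hx, by linarith⟩
    · rintro (⟨hx, h3⟩ | ⟨hx, h3⟩)
      · refine ⟨hx, fun h4 => ?_⟩
        have := (abs_le.1 h4.2).1
        linarith
      · refine ⟨by simpa using hKs _ hx, fun h4 => ?_⟩
        have := (abs_le.1 h4.2).2
        linarith
  have hDneg : MeasurableSet {x | -x ∈ D} := measurable_neg hDm
  have hdisj : Disjoint D {x | -x ∈ D} := by
    rw [Set.disjoint_left]
    rintro x ⟨-, hx1⟩ ⟨-, hx2⟩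
    simp only [hU, mem_ofPred_eq, inner_neg_left] at hx1 hx2
    linarith
  have hVneg : volume {x | -x ∈ D} = volume D := Measure.measure_preimage_neg volume D
  have hVeq : (volume (K \ K')).toReal = 2 * (volume D).toReal := by
    rw [hdiff, measure_union hdisj hDneg, hVneg, ENNReal.toReal_add hDfin hDfin]; ring
  have hIeq : ∫ x in K \ K', isoDensity K x = 2 * ∫ x in D, isoDensity K x := by
    have hneg : ∫ x in {x | -x ∈ D}, isoDensity K x = ∫ x in D, isoDensity K x := by
      rw [← setIntegral_preimage_neg (isoDensity K) D]
      simp only [isoDensity_neg]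
    rw [hdiff, setIntegral_union hdisj hDneg
      (integrableOn_of_continuous hK.1 inter_subset_left (continuous_isoDensity K))
      (integrableOn_of_continuous hK.1 (fun x hx => by simpa using hKs _ hx.1)
        (continuous_isoDensity K)), hneg]
    ring
  refine ⟨K', hbody, hsym', ?_, ?_⟩
  · have hclose : ∀ x ∈ D, ∃ y ∈ K', dist x y ≤ d * r + ‖X₀‖ / σ * r := by
      intro x hx
      have hz : ‖x - X₀‖ ≤ d * r := by
        have hx' : x - X₀ ∈ {z | X₀ + z ∈ K ∧ ⟪z, N⟫_ℝ < r ^ 2} := by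
          rw [hDcap]; simpa using hx
        exact hcapr _ hx'.1 hx'.2
      have hτ : r ^ 2 / σ ≤ 1 := (div_le_one hσpos).2 (by linarith)
      have hτ0 : 0 ≤ r ^ 2 / σ := by positivity
      refine ⟨(1 - r ^ 2 / σ) • X₀, ⟨hK.2.1.smul_mem_of_zero_mem (interior_subset h0) hX₀
        ⟨by linarith, by linarith⟩, ?_⟩, ?_⟩
      · simp only [mem_ofPred_eq, real_inner_smul_left, hXN]
        have e1 : (1 - r ^ 2 / σ) * -σ = -(σ - r ^ 2) := by field_simp
        rw [e1, abs_neg, abs_of_pos hσr]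
      · rw [dist_eq_norm]
        have e1 : x - (1 - r ^ 2 / σ) • X₀ = (x - X₀) + (r ^ 2 / σ) • X₀ := by module
        rw [e1]
        refine (norm_add_le _ _).trans (add_le_add hz ?_)
        rw [norm_smul, Real.norm_eq_abs, abs_of_nonneg hτ0]
        calc r ^ 2 / σ * ‖X₀‖ ≤ r / σ * ‖X₀‖ := by gcongr
          _ = ‖X₀‖ / σ * r := by ring
    refine lt_of_le_of_lt (hausdorffDist_le_of_mem_dist (r := d * r + ‖X₀‖ / σ * r)
      (by positivity) ?_ ?_) (by linarith)
    · exact fun x hx => ⟨x, hsub hx, by rw [dist_self]; positivity⟩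
    · intro x hx
      by_cases hxK : x ∈ K'
      · exact ⟨x, hxK, by rw [dist_self]; positivity⟩
      have hxD : x ∈ D ∪ {x | -x ∈ D} := by rw [← hdiff]; exact ⟨hx, hxK⟩
      rcases hxD with hxD | hxD
      · exact hclose x hxD
      · obtain ⟨y, hy, hxy⟩ := hclose (-x) hxD
        refine ⟨-y, forall_neg_mem_of_eq_neg hsym' y hy, ?_⟩
        rwa [← dist_neg_neg, neg_neg]
  · refine isoL_lt_isoL_of_subset (by omega) hK.1 hbody.1 hsym hsym' hbody.volume_pos hsub ?_
    rw [hIeq, hVeq]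
    set V := (volume D).toReal
    have h1 : A * V ≤ A * δ * r ^ 2 := by
      have := mul_le_mul_of_nonneg_left hDle hApos.le
      linarith
    have h2 : 2 * A * δ * r ^ 2 < c * r ^ 2 := mul_lt_mul_of_pos_right hδA (by positivity)
    have h3 : A * (2 * V) ^ 2 < 2 * (c * r ^ 2 * V) := by
      calc A * (2 * V) ^ 2 = 4 * (A * V) * V := by ring
        _ ≤ 2 * (2 * A * δ * r ^ 2) * V := mul_le_mul_of_nonneg_right (by linarith) hDpos.le
        _ < 2 * (c * r ^ 2) * V := mul_lt_mul_of_pos_right (by linarith) hDpos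
        _ = _ := by ring
    linarith

/-! ### The osculating form of a body at a point of positive generalized curvature -/

/-- Projection along a unit vector `N` onto `Nᗮ`. -/
def projPerp {n : ℕ} (N : EuclideanSpace ℝ (Fin n)) :
    EuclideanSpace ℝ (Fin n) →ₗ[ℝ] EuclideanSpace ℝ (Fin n) where
  toFun z := z - ⟪z, N⟫_ℝ • N
  map_add' x y := by rw [inner_add_left]; module
  map_smul' a x := by rw [real_inner_smul_left, RingHom.id_apply]; module

lemma projPerp_apply {n : ℕ} (N z : EuclideanSpace ℝ (Fin n)) :
    projPerp N z = z - ⟪z, N⟫_ℝ • N := rfl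

lemma inner_projPerp {n : ℕ} {N : EuclideanSpace ℝ (Fin n)} (hN : ‖N‖ = 1)
    (z : EuclideanSpace ℝ (Fin n)) : ⟪projPerp N z, N⟫_ℝ = 0 := by
  rw [projPerp_apply, inner_sub_left, real_inner_smul_left, real_inner_self_eq_norm_sq, hN]; ring

/-- The bilinear form of `q` on `Nᗮ`, extended by zero along `N`. -/
def tangentForm {n : ℕ} (N : EuclideanSpace ℝ (Fin n))
    (q : QuadraticForm ℝ (EuclideanSpace ℝ (Fin n))) :
    EuclideanSpace ℝ (Fin n) →ₗ[ℝ] EuclideanSpace ℝ (Fin n) →ₗ[ℝ] ℝ :=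
  (QuadraticMap.associatedHom ℝ q).compl₁₂ (projPerp N) (projPerp N)

lemma tangentForm_self {n : ℕ} (N : EuclideanSpace ℝ (Fin n))
    (q : QuadraticForm ℝ (EuclideanSpace ℝ (Fin n))) (z : EuclideanSpace ℝ (Fin n)) :
    tangentForm N q z z = q (projPerp N z) := by
  rw [tangentForm, LinearMap.compl₁₂_apply, QuadraticMap.associated_eq_self_apply]

lemma continuous_bilin_self {n : ℕ}
    (B : EuclideanSpace ℝ (Fin n) →ₗ[ℝ] EuclideanSpace ℝ (Fin n) →ₗ[ℝ] ℝ) :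
    Continuous fun z => B z z := by
  have e : (fun z => B z z) = fun z => B.toContinuousBilinearMap z z := by
    ext z; rw [LinearMap.toContinuousBilinearMap_apply]
  rw [e]
  fun_prop

/-- A continuous positive function on the sphere, homogeneous of degree two, is comparable to the
squared norm. -/
lemma exists_bounds_of_homogeneous {n : ℕ} {f : EuclideanSpace ℝ (Fin n) → ℝ}
    (hf : Continuous f) (hpos : ∀ z, z ≠ 0 → 0 < f z)
    (hsmul : ∀ (a : ℝ) z, f (a • z) = a ^ 2 * f z) :
    (∃ m > 0, ∀ z, m * ‖z‖ ^ 2 ≤ f z) ∧ ∃ M > 0, ∀ z, f z ≤ M * ‖z‖ ^ 2 := by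
  have hf0 : f 0 = 0 := by simpa using hsmul 0 0
  have hcomp : IsCompact (sphere (0 : EuclideanSpace ℝ (Fin n)) 1) := isCompact_sphere _ _
  have hscale : ∀ z : EuclideanSpace ℝ (Fin n), z ≠ 0 →
      ‖z‖⁻¹ • z ∈ sphere (0 : EuclideanSpace ℝ (Fin n)) 1 ∧ f z = ‖z‖ ^ 2 * f (‖z‖⁻¹ • z) := by
    intro z hz
    have hz' : ‖z‖ ≠ 0 := norm_ne_zero_iff.2 hz
    refine ⟨by simp [norm_smul, hz'], ?_⟩
    rw [hsmul, inv_pow, mul_inv_cancel_left₀ (pow_ne_zero 2 hz')]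
  rcases (sphere (0 : EuclideanSpace ℝ (Fin n)) 1).eq_empty_or_nonempty with he | hne
  · have hz0 : ∀ z : EuclideanSpace ℝ (Fin n), z = 0 := fun z => by
      by_contra hz
      have := (hscale z hz).1
      rw [he] at this
      exact this
    exact ⟨⟨1, one_pos, fun z => by rw [hz0 z]; simp [hf0]⟩,
      ⟨1, one_pos, fun z => by rw [hz0 z]; simp [hf0]⟩⟩
  have hne0 : ∀ y ∈ sphere (0 : EuclideanSpace ℝ (Fin n)) 1, 0 < f y := fun y hy =>
    hpos y fun h => by simp [h] at hy
  obtain ⟨y₁, hy₁, hmin⟩ := hcomp.exists_isMinOn hne hf.continuousOn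
  obtain ⟨y₂, hy₂, hmax⟩ := hcomp.exists_isMaxOn hne hf.continuousOn
  refine ⟨⟨f y₁, hne0 y₁ hy₁, fun z => ?_⟩, ⟨f y₂, hne0 y₂ hy₂, fun z => ?_⟩⟩
  · rcases eq_or_ne z 0 with rfl | hz
    · simp [hf0]
    · obtain ⟨h1, h2⟩ := hscale z hz
      rw [h2, mul_comm]
      exact mul_le_mul_of_nonneg_left (hmin h1) (sq_nonneg _)
  · rcases eq_or_ne z 0 with rfl | hz
    · simp [hf0]
    · obtain ⟨h1, h2⟩ := hscale z hz
      rw [h2, mul_comm (f y₂)]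
      exact mul_le_mul_of_nonneg_left (hmax h1) (sq_nonneg _)

lemma osculates_of_curvWitness {n : ℕ} {K : Set (EuclideanSpace ℝ (Fin n))}
    (hK : IsConvexBody K) (h0 : (0 : EuclideanSpace ℝ (Fin n)) ∈ interior K)
    {X₀ N : EuclideanSpace ℝ (Fin n)} (hX₀ : X₀ ∈ K)
    {q : QuadraticForm ℝ (EuclideanSpace ℝ (Fin n))} (hq : CurvWitness K X₀ N q) :
    Osculates {z | X₀ + z ∈ K} N (tangentForm N q) := by
  obtain ⟨hN, hsupp, hpos, hcurv⟩ := hq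
  have hpos' : ∀ z, 0 ≤ tangentForm N q z z := fun z => by
    rw [tangentForm_self]
    rcases eq_or_ne (projPerp N z) 0 with h | h
    · rw [h, map_zero]
    · exact (hpos _ (inner_projPerp hN z) h).le
  have hbounds := exists_bounds_of_homogeneous
    (f := fun z => tangentForm N q z z + ⟪z, N⟫_ℝ ^ 2)
    ((continuous_bilin_self _).add (by fun_prop)) (fun z hz => by
      rcases eq_or_ne (projPerp N z) 0 with h | h
      · have hzN : ⟪z, N⟫_ℝ ≠ 0 := fun h' => hz (by simpa [projPerp_apply, h'] using h)
        have : 0 < ⟪z, N⟫_ℝ ^ 2 := by positivity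
        linarith [hpos' z]
      · have := hpos _ (inner_projPerp hN z) h
        rw [← tangentForm_self] at this
        positivity)
    (fun a z => by
      simp only [map_smul, LinearMap.smul_apply, smul_eq_mul, real_inner_smul_left]; ring)
  refine
    { isCompact := ((Homeomorph.addLeft X₀).isCompact_preimage).2 hK.1
      convex := hK.2.1.translate_preimage_right X₀
      zero_mem := by simpa using hX₀
      inner_nonneg := fun z hz => by simpa using hsupp _ hz
      exists_inner_pos := ⟨-X₀, by simpa using interior_subset h0, ?_⟩
      norm_eq_one := hN
      symm := fun u v => QuadraticMap.associated_isSymm ℝ q _ _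
      ker := fun z => ?_
      nonneg := hpos'
      lower := hbounds.1
      upper := ?_
      curv := ?_ }
  · have := inner_lt_zero_of_supporting h0 hN hsupp
    rw [inner_neg_left]; linarith
  · have : projPerp N N = 0 := by
      rw [projPerp_apply, real_inner_self_eq_norm_sq, hN]; simp
    rw [tangentForm, LinearMap.compl₁₂_apply, this, map_zero, LinearMap.zero_apply]
  · obtain ⟨M, hM, h⟩ := hbounds.2
    exact ⟨M, hM, fun z => le_trans (by linarith [sq_nonneg ⟪z, N⟫_ℝ]) (h z)⟩
  · intro ε hε
    obtain ⟨a, ha, h⟩ := hcurv ε hε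
    refine ⟨a, ha, fun z hz hza => ?_⟩
    rw [tangentForm_self]
    refine h _ _ (inner_projPerp hN z) ?_
    have e : X₀ + projPerp N z + ⟪z, N⟫_ℝ • N = X₀ + z := by rw [projPerp_apply]; module
    rw [e]
    refine ⟨?_, by simpa using hza⟩
    have hf := (Homeomorph.addLeft X₀).preimage_frontier K
    have hz' : z ∈ (Homeomorph.addLeft X₀) ⁻¹' frontier K := by rw [hf]; exact hz
    exact hz'

/-! ### The sign of the density near the contact point -/

lemma isoDensity_add {n : ℕ} (K : Set (EuclideanSpace ℝ (Fin n)))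
    (X₀ z : EuclideanSpace ℝ (Fin n)) :
    isoDensity K (X₀ + z)
      = isoDensity K X₀ + 2 * ⟪X₀, inertiaOp K z⟫_ℝ + ⟪z, inertiaOp K z⟫_ℝ := by
  simp only [isoDensity, map_add, inner_add_left, inner_add_right]
  rw [inner_inertiaOp_symm K z X₀]; ring

lemma inner_inertiaOp_nonneg {n : ℕ} {K : Set (EuclideanSpace ℝ (Fin n))} (hK : IsConvexBody K)
    (z : EuclideanSpace ℝ (Fin n)) : 0 ≤ ⟪z, inertiaOp K z⟫_ℝ := by
  rcases eq_or_ne z 0 with rfl | hz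
  · simp
  · exact (inner_inertiaOp_pos hK.1 hK.volume_pos hz).le

lemma exists_ne_zero_inner_eq_zero {n : ℕ} (hn : 2 ≤ n) (N : EuclideanSpace ℝ (Fin n)) :
    ∃ Y : EuclideanSpace ℝ (Fin n), ⟪Y, N⟫_ℝ = 0 ∧ Y ≠ 0 := by
  have hne : (ℝ ∙ N)ᗮ ≠ ⊥ := by
    intro h
    rw [Submodule.orthogonal_eq_bot_iff] at h
    have h1 := finrank_span_le_card (R := ℝ) ({N} : Set (EuclideanSpace ℝ (Fin n)))
    rw [h, finrank_top, finrank_euclideanSpace_fin] at h1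
    simp at h1
    omega
  obtain ⟨Y, hY, hY0⟩ := Submodule.exists_mem_ne_zero_of_ne_bot hne
  exact ⟨Y, Submodule.mem_orthogonal_singleton_iff_inner_left.1 hY, hY0⟩

section Cases

variable {n : ℕ} {K : Set (EuclideanSpace ℝ (Fin n))} {X₀ N : EuclideanSpace ℝ (Fin n)}
  {B : EuclideanSpace ℝ (Fin n) →ₗ[ℝ] EuclideanSpace ℝ (Fin n) →ₗ[ℝ] ℝ}

lemma norm_le_of_norm_sub_smul_le {Y₀ z : EuclideanSpace ℝ (Fin n)} {r η : ℝ} (hr : 0 < r)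
    (hz : ‖z - r • Y₀‖ ≤ η * r) : ‖z‖ ≤ (‖Y₀‖ + η) * r := by
  have h1 : ‖z‖ ≤ ‖z - r • Y₀‖ + ‖r • Y₀‖ := by simpa using norm_add_le (z - r • Y₀) (r • Y₀)
  rw [norm_smul, Real.norm_eq_abs, abs_of_pos hr] at h1
  linarith

lemma exists_isoL_lt_of_isoDensity_pos (hn : 2 ≤ n) (hK : IsConvexBody K) (hsym : K = -K)
    (h : Osculates {z | X₀ + z ∈ K} N B) (hpos : 0 < isoDensity K X₀) {ε : ℝ} (hε : 0 < ε) :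
    ∃ K' : Set (EuclideanSpace ℝ (Fin n)),
      IsConvexBody K' ∧ K' = -K' ∧ hausdorffDist K' K < ε ∧ isoL n K < isoL n K' := by
  obtain ⟨Y₀, hY, hY0⟩ := exists_ne_zero_inner_eq_zero hn N
  have hcont : Continuous fun z => isoDensity K (X₀ + z) :=
    (continuous_isoDensity K).comp (by fun_prop)
  have hev : ∀ᶠ z in 𝓝 (0 : EuclideanSpace ℝ (Fin n)), isoDensity K X₀ / 2 < isoDensity K (X₀ + z) :=
    hcont.continuousAt.eventually_const_lt (by simpa using half_lt_self hpos)
  obtain ⟨ρ, hρ, hball⟩ := Metric.eventually_nhds_iff.1 hev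
  refine exists_isoL_lt_of_le_isoDensity hn hK hsym h hY hY0 one_pos (half_pos hpos) ?_ hε
  filter_upwards [eventually_pos_nhdsGT, eventually_mul_lt 1 one_pos,
    eventually_mul_lt (‖Y₀‖ + 1) hρ] with r hr hr1 hrρ x hx _ _
  have h1 := hball (y := x)
    (by simpa using (norm_le_of_norm_sub_smul_le hr hx).trans_lt hrρ)
  have h2 : r ^ 2 ≤ 1 := by nlinarith
  nlinarith

lemma volume_cap_ne_top (hK : IsConvexBody K) (d : ℝ) :
    volume {z | X₀ + z ∈ K ∧ ⟪z, N⟫_ℝ < d} ≠ ⊤ := by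
  have h1 : volume {z | X₀ + z ∈ K} = volume K := measure_preimage_add volume X₀ K
  exact ((measure_mono fun z hz => hz.1).trans_lt (h1.trans_lt hK.1.measure_lt_top)).ne

lemma measurableSet_cap (hK : IsConvexBody K) (d : ℝ) :
    MeasurableSet {z | X₀ + z ∈ K ∧ ⟪z, N⟫_ℝ < d} :=
  (measurable_const_add X₀ hK.1.measurableSet).inter
    (isOpen_lt (by fun_prop : Continuous fun z => ⟪z, N⟫_ℝ) continuous_const).measurableSet

lemma integrableOn_cap (hK : IsConvexBody K) (d : ℝ) :
    IntegrableOn (fun z => isoDensity K (X₀ + z)) {z | X₀ + z ∈ K ∧ ⟪z, N⟫_ℝ < d} :=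
  integrableOn_of_continuous (((Homeomorph.addLeft X₀).isCompact_preimage).2 hK.1)
    (fun _ hz => hz.1) ((continuous_isoDensity K).comp (by fun_prop))

lemma exists_isoL_lt_of_isoDensity_neg (hn : 2 ≤ n) (hK : IsConvexBody K) (hsym : K = -K)
    (h : Osculates {z | X₀ + z ∈ K} N B) (hneg : isoDensity K X₀ < 0) {ε : ℝ} (hε : 0 < ε) :
    ∃ K' : Set (EuclideanSpace ℝ (Fin n)),
      IsConvexBody K' ∧ K' = -K' ∧ hausdorffDist K' K < ε ∧ isoL n K < isoL n K' := by
  have hcont : Continuous fun z => isoDensity K (X₀ + z) :=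
    (continuous_isoDensity K).comp (by fun_prop)
  have hev : ∀ᶠ z in 𝓝 (0 : EuclideanSpace ℝ (Fin n)),
      isoDensity K (X₀ + z) < isoDensity K X₀ / 2 :=
    hcont.continuousAt.eventually_lt_const (by simp; linarith)
  obtain ⟨ρ, hρ, hball⟩ := Metric.eventually_nhds_iff.1 hev
  obtain ⟨d, hd, hcap⟩ := h.exists_norm_le_of_inner_lt
  refine exists_isoL_lt_of_setIntegral_isoDensity_le hn hK hsym h
    (c := -(isoDensity K X₀ / 2)) (by linarith) ?_ hε
  filter_upwards [eventually_pos_nhdsGT, eventually_mul_lt 1 one_pos,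
    eventually_mul_lt d hρ, hcap] with r hr hr1 hrρ hcapr
  have h1 : ∫ z in {z | X₀ + z ∈ K ∧ ⟪z, N⟫_ℝ < r ^ 2}, isoDensity K (X₀ + z)
      ≤ ∫ _ in {z | X₀ + z ∈ K ∧ ⟪z, N⟫_ℝ < r ^ 2}, isoDensity K X₀ / 2 :=
    setIntegral_mono_on (integrableOn_cap hK _) (integrableOn_const (volume_cap_ne_top hK _))
      (measurableSet_cap hK _) fun z hz =>
        (hball (by simpa using (hcapr z hz.1 hz.2).trans_lt hrρ)).le
  refine h1.trans ?_
  rw [setIntegral_const, smul_eq_mul, Measure.real]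
  set V := (volume {z | X₀ + z ∈ K ∧ ⟪z, N⟫_ℝ < r ^ 2}).toReal
  have hV : 0 ≤ V := ENNReal.toReal_nonneg
  have h2 : r ^ 2 ≤ 1 := by nlinarith
  have h3 : 0 ≤ (1 - r ^ 2) * (V * -(isoDensity K X₀ / 2)) :=
    mul_nonneg (by linarith) (mul_nonneg hV (by linarith))
  linarith

lemma exists_isoL_lt_of_tangential_pos (hn : 2 ≤ n) (hK : IsConvexBody K) (hsym : K = -K)
    (h : Osculates {z | X₀ + z ∈ K} N B) (hzero : isoDensity K X₀ = 0)
    {Y₀ : EuclideanSpace ℝ (Fin n)} (hY : ⟪Y₀, N⟫_ℝ = 0) (hpos : 0 < ⟪X₀, inertiaOp K Y₀⟫_ℝ)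
    {ε : ℝ} (hε : 0 < ε) :
    ∃ K' : Set (EuclideanSpace ℝ (Fin n)),
      IsConvexBody K' ∧ K' = -K' ∧ hausdorffDist K' K < ε ∧ isoL n K < isoL n K' := by
  have hY0 : Y₀ ≠ 0 := fun h => by simp [h] at hpos
  set b := ⟪X₀, inertiaOp K Y₀⟫_ℝ with hb
  set S := ‖X₀‖ * ‖inertiaOp K‖ with hS
  have hS0 : 0 ≤ S := by positivity
  refine exists_isoL_lt_of_le_isoDensity hn hK hsym h hY hY0
    (η := b / (2 * (S + 1))) (by positivity) hpos ?_ hε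
  filter_upwards [eventually_pos_nhdsGT, eventually_mul_lt 1 one_pos] with r hr hr1 x hx _ _
  have hSη : 2 * (S * (b / (2 * (S + 1)))) ≤ b := by
    rw [← mul_div_assoc, ← mul_div_assoc, div_le_iff₀ (by positivity)]
    nlinarith
  have h1 : |⟪X₀, inertiaOp K (x - r • Y₀)⟫_ℝ| ≤ S * (b / (2 * (S + 1)) * r) := by
    refine (abs_real_inner_le_norm _ _).trans ?_
    rw [hS, mul_assoc]
    refine mul_le_mul_of_nonneg_left ?_ (norm_nonneg _)
    exact ((inertiaOp K).le_opNorm _).trans (mul_le_mul_of_nonneg_left hx (norm_nonneg _))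
  have h2 := (abs_le.1 h1).1
  rw [map_sub, map_smul, inner_sub_right, real_inner_smul_right, ← hb] at h2
  have h3 := inner_inertiaOp_nonneg hK x
  have h4 := mul_le_mul_of_nonneg_right hSη hr.le
  rw [isoDensity_add, hzero]
  have h5 : b * r ^ 2 ≤ b * r := mul_le_mul_of_nonneg_left (by nlinarith) hpos.le
  linarith

lemma exists_isoL_lt_of_curvature_lt (hn : 2 ≤ n) (hK : IsConvexBody K) (hsym : K = -K)
    (h : Osculates {z | X₀ + z ∈ K} N B) {R : ℝ} (hR : 0 < R)
    (hdens : ∀ z, isoDensity K (X₀ + z) = -2 * R * ⟪z, N⟫_ℝ + ⟪z, inertiaOp K z⟫_ℝ)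
    {Y₀ : EuclideanSpace ℝ (Fin n)} (hY : ⟪Y₀, N⟫_ℝ = 0)
    (hlt : 2 * R * B Y₀ Y₀ < ⟪Y₀, inertiaOp K Y₀⟫_ℝ) {ε : ℝ} (hε : 0 < ε) :
    ∃ K' : Set (EuclideanSpace ℝ (Fin n)),
      IsConvexBody K' ∧ K' = -K' ∧ hausdorffDist K' K < ε ∧ isoL n K < isoL n K' := by
  have hY0 : Y₀ ≠ 0 := fun h => by simp [h] at hlt
  set G : ℝ × EuclideanSpace ℝ (Fin n) → ℝ := fun w =>
    ⟪w.2, inertiaOp K w.2⟫_ℝ - 2 * R * ((1 + w.1) * B w.2 w.2) with hG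
  have hGc : Continuous G := by
    have h1 : Continuous fun w : ℝ × EuclideanSpace ℝ (Fin n) => B w.2 w.2 :=
      (continuous_bilin_self B).comp continuous_snd
    have h2 : Continuous fun w : ℝ × EuclideanSpace ℝ (Fin n) => ⟪w.2, inertiaOp K w.2⟫_ℝ := by
      fun_prop
    exact h2.sub (continuous_const.mul ((continuous_const.add continuous_fst).mul h1))
  have hG0 : 0 < G (0, Y₀) := by simp only [hG]; linarith
  have hev : ∀ᶠ w in 𝓝 ((0 : ℝ), Y₀), G (0, Y₀) / 2 < G w :=
    hGc.continuousAt.eventually_const_lt (half_lt_self hG0)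
  obtain ⟨ρ, hρ, hball⟩ := Metric.eventually_nhds_iff.1 hev
  refine exists_isoL_lt_of_le_isoDensity hn hK hsym h hY hY0
    (half_pos hρ) (half_pos hG0) ?_ hε
  filter_upwards [eventually_pos_nhdsGT] with r hr x hx _ hxB
  have hxr : ‖r⁻¹ • x - Y₀‖ ≤ ρ / 2 := by
    have e : r⁻¹ • x - Y₀ = r⁻¹ • (x - r • Y₀) := by
      rw [smul_sub, smul_smul, inv_mul_cancel₀ hr.ne', one_smul]
    rw [e, norm_smul, norm_inv, Real.norm_eq_abs, abs_of_pos hr, inv_mul_le_iff₀ hr, mul_comm r]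
    exact hx
  have h1 := hball (y := (ρ / 2, r⁻¹ • x)) (by
    rw [Prod.dist_eq, max_lt_iff]
    refine ⟨?_, ?_⟩
    · simp only [Real.dist_eq, sub_zero]
      rw [abs_of_pos (half_pos hρ)]; linarith
    · simp only [dist_eq_norm]; linarith)
  have h2 : r ^ 2 * G (ρ / 2, r⁻¹ • x)
      = ⟪x, inertiaOp K x⟫_ℝ - 2 * R * ((1 + ρ / 2) * B x x) := by
    simp only [hG, map_smul, LinearMap.smul_apply, smul_eq_mul, real_inner_smul_left,
      real_inner_smul_right]
    field_simp
  have h3 := mul_le_mul_of_nonneg_left h1.le (sq_nonneg r)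
  rw [h2] at h3
  have h4 := mul_le_mul_of_nonneg_left hxB (show 0 ≤ 2 * R by linarith)
  rw [hdens]
  linarith

lemma inner_inertiaOp_le_of_tangential (hK : IsConvexBody K) (h : Osculates {z | X₀ + z ∈ K} N B) {R : ℝ}
    (hle : ∀ Y, ⟪Y, N⟫_ℝ = 0 → ⟪Y, inertiaOp K Y⟫_ℝ ≤ 2 * R * B Y Y)
    (z : EuclideanSpace ℝ (Fin n)) (hz : 0 ≤ ⟪z, N⟫_ℝ) :
    ⟪z, inertiaOp K z⟫_ℝ ≤ 2 * R * B z z + 2 * ⟪z, N⟫_ℝ * (‖inertiaOp K‖ * ‖z‖) := by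
  set t := ⟪z, N⟫_ℝ with ht
  set Y := z + (-t) • N with hYdef
  have hYN : ⟪Y, N⟫_ℝ = 0 := by
    rw [hYdef, inner_add_left, real_inner_smul_left, h.inner_self, ← ht]; ring
  have h1 := hle Y hYN
  have hBY : B Y Y = B z z := by rw [hYdef, h.apply_add_smul_normal]
  rw [hBY] at h1
  have h2 : ⟪Y, inertiaOp K Y⟫_ℝ
      = ⟪z, inertiaOp K z⟫_ℝ - 2 * t * ⟪N, inertiaOp K z⟫_ℝ + t ^ 2 * ⟪N, inertiaOp K N⟫_ℝ := by
    simp only [hYdef, map_add, map_smul, inner_add_left, inner_add_right, real_inner_smul_left,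
      real_inner_smul_right]
    rw [inner_inertiaOp_symm K z N]; ring
  have h3 : |⟪N, inertiaOp K z⟫_ℝ| ≤ ‖inertiaOp K‖ * ‖z‖ := by
    refine (abs_real_inner_le_norm _ _).trans ?_
    rw [h.norm_eq_one, one_mul]
    exact (inertiaOp K).le_opNorm _
  have h4 := mul_le_mul_of_nonneg_left ((le_abs_self _).trans h3) (show 0 ≤ 2 * t by linarith)
  have h5 := mul_nonneg (sq_nonneg t) (inner_inertiaOp_nonneg hK N)
  linarith

/-- A set `S'` which maps onto `S` under `w ↦ 2w - a` has `2⁻ⁿ` times its volume. -/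
lemma volume_preimage_two_smul_sub (S : Set (EuclideanSpace ℝ (Fin n)))
    (a : EuclideanSpace ℝ (Fin n)) :
    (volume {w | (2 : ℝ) • w - a ∈ S}).toReal = (2 ^ n)⁻¹ * (volume S).toReal := by
  have h1 := Measure.addHaar_preimage_smul (volume : Measure (EuclideanSpace ℝ (Fin n)))
    (two_ne_zero (α := ℝ)) {x | x + -a ∈ S}
  have h2 : volume {x | x + -a ∈ S} = volume S := measure_preimage_add_right volume (-a) S
  have h3 : {w | (2 : ℝ) • w - a ∈ S} = ((2 : ℝ) • ·) ⁻¹' {x | x + -a ∈ S} := by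
    ext w; simp [sub_eq_add_neg]
  rw [h3, h1, h2, ENNReal.toReal_mul, ENNReal.toReal_ofReal (abs_nonneg _),
    finrank_euclideanSpace_fin, abs_of_pos (by positivity)]

/-- If the height exceeds the quadratic form by a definite amount on average, caps carry negative
density. -/
lemma exists_isoL_lt_of_le_curvature (hn : 2 ≤ n) (hK : IsConvexBody K) (hsym : K = -K)
    (h : Osculates {z | X₀ + z ∈ K} N B) {R : ℝ} (hR : 0 < R)
    (hdens : ∀ z, isoDensity K (X₀ + z) = -2 * R * ⟪z, N⟫_ℝ + ⟪z, inertiaOp K z⟫_ℝ)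
    (hle : ∀ Y, ⟪Y, N⟫_ℝ = 0 → ⟪Y, inertiaOp K Y⟫_ℝ ≤ 2 * R * B Y Y)
    {ε : ℝ} (hε : 0 < ε) :
    ∃ K' : Set (EuclideanSpace ℝ (Fin n)),
      IsConvexBody K' ∧ K' = -K' ∧ hausdorffDist K' K < ε ∧ isoL n K < isoL n K' := by
  set θ : ℝ := (2 ^ n)⁻¹ with hθ
  have hθ0 : 0 < θ := by positivity
  have hθ1 : θ ≤ 1 := inv_le_one_of_one_le₀ (one_le_pow₀ (by norm_num))
  obtain ⟨a₁, ha₁, hA⟩ := h.le_inner_of_mem (ε := θ / 8) (by positivity)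
  obtain ⟨a₂, ha₂, hB⟩ := h.mem_of_le one_pos
  obtain ⟨d, hd, hcap⟩ := h.exists_norm_le_of_inner_lt
  set S := 2 * (‖inertiaOp K‖ * d) with hS
  have hS0 : 0 ≤ S := by positivity
  refine exists_isoL_lt_of_setIntegral_isoDensity_le hn hK hsym h
    (c := R * θ / 4) (by positivity) ?_ hε
  filter_upwards [eventually_pos_nhdsGT, eventually_mul_lt 1 one_pos, eventually_mul_lt d ha₁,
    eventually_mul_lt 1 ha₂, eventually_mul_lt S (show 0 < R * θ / 4 by positivity), hcap]
    with r hr hr1 hra₁ hra₂ hrS hcapr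
  have hrr : r ^ 2 ≤ r := by nlinarith
  set D := {z | X₀ + z ∈ K ∧ ⟪z, N⟫_ℝ < r ^ 2} with hD
  have hDm : MeasurableSet D := measurableSet_cap hK _
  have hDfin : volume D ≠ ⊤ := volume_cap_ne_top hK _
  have hrN : r ^ 2 • N ∈ {z | X₀ + z ∈ K} := by
    refine hB _ ?_ ?_
    · rw [norm_smul, h.norm_eq_one, Real.norm_eq_abs, abs_of_nonneg (sq_nonneg r)]; linarith
    · have e : B (r ^ 2 • N) (r ^ 2 • N) = 0 := by simp [h.ker]
      rw [e, real_inner_smul_left, h.inner_self, mul_zero, mul_one]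
      positivity
  set D' := {w | (2 : ℝ) • w - r ^ 2 • N ∈ D} with hD'
  have hD'm : MeasurableSet D' :=
    (Continuous.measurable (by fun_prop :
      Continuous fun w : EuclideanSpace ℝ (Fin n) => (2 : ℝ) • w - r ^ 2 • N)) hDm
  have hD'D : D' ⊆ D := by
    intro w hw
    have h1 := h.convex hw.1 hrN (a := 1 / 2) (b := 1 / 2) (by norm_num) (by norm_num)
      (by norm_num)
    have e : (1 / 2 : ℝ) • ((2 : ℝ) • w - r ^ 2 • N) + (1 / 2 : ℝ) • r ^ 2 • N = w := by module
    rw [e] at h1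
    have h2 := hw.2
    rw [inner_sub_left, real_inner_smul_left, real_inner_smul_left, h.inner_self] at h2
    exact ⟨h1, by linarith⟩
  have hform : ∀ z ∈ D, (1 - θ / 8) * B z z ≤ ⟪z, N⟫_ℝ := fun z hz =>
    hA z hz.1 ((hcapr z hz.1 hz.2).trans_lt hra₁)
  have hψ : ∀ z ∈ D, isoDensity K (X₀ + z) ≤ 2 * R * (B z z - ⟪z, N⟫_ℝ) + S * r * r ^ 2 := by
    intro z hz
    have hz0 := h.inner_nonneg z hz.1
    have h1 := inner_inertiaOp_le_of_tangential hK h hle z hz0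
    have h2 : 2 * ⟪z, N⟫_ℝ * (‖inertiaOp K‖ * ‖z‖) ≤ 2 * r ^ 2 * (‖inertiaOp K‖ * (d * r)) := by
      have := hz.2.le
      have := hcapr z hz.1 hz.2
      gcongr
    rw [hdens]
    have e : 2 * r ^ 2 * (‖inertiaOp K‖ * (d * r)) = S * r * r ^ 2 := by rw [hS]; ring
    linarith
  have hub : ∀ z ∈ D, isoDensity K (X₀ + z)
      ≤ (R * θ / 2 * r ^ 2 + S * r * r ^ 2) + D'.indicator (fun _ => -(R * r ^ 2)) z := by
    intro z hz
    have h1 := hψ z hz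
    have h2 := hform z hz
    have hz0 := h.inner_nonneg z hz.1
    have hB0 := h.nonneg z
    have hrθ : 0 ≤ R * θ / 2 * r ^ 2 := by positivity
    by_cases hzD' : z ∈ D'
    · rw [Set.indicator_of_mem hzD']
      have hw := hform _ hzD'
      have hw0 := h.inner_nonneg _ hzD'.1
      have hBw : B ((2 : ℝ) • z - r ^ 2 • N) ((2 : ℝ) • z - r ^ 2 • N) = 4 * B z z := by
        have e : (2 : ℝ) • z - r ^ 2 • N = (2 : ℝ) • z + (-r ^ 2) • N := by module
        rw [e, h.apply_add_smul_normal, map_smul, map_smul, LinearMap.smul_apply, smul_eq_mul,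
          smul_eq_mul]
        ring
      rw [hBw] at hw
      rw [inner_sub_left, real_inner_smul_left, real_inner_smul_left, h.inner_self] at hw hw0
      have h3 : B z z - ⟪z, N⟫_ℝ ≤ -(r ^ 2 / 2) := by nlinarith
      have h4 := mul_le_mul_of_nonneg_left h3 (show 0 ≤ 2 * R by linarith)
      linarith
    · rw [Set.indicator_of_notMem hzD']
      have h5 : B z z ≤ 2 * r ^ 2 := by nlinarith [hz.2]
      have h3 : B z z - ⟪z, N⟫_ℝ ≤ θ / 4 * r ^ 2 := by nlinarith
      have h4 := mul_le_mul_of_nonneg_left h3 (show 0 ≤ 2 * R by linarith)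
      linarith
  have hind : IntegrableOn (D'.indicator fun _ => -(R * r ^ 2)) D :=
    (integrableOn_const hDfin).indicator hD'm
  have hconst : IntegrableOn (fun _ : EuclideanSpace ℝ (Fin n) =>
      R * θ / 2 * r ^ 2 + S * r * r ^ 2) D := integrableOn_const hDfin
  have h1 : ∫ z in D, isoDensity K (X₀ + z)
      ≤ ∫ z in D, ((R * θ / 2 * r ^ 2 + S * r * r ^ 2)
        + D'.indicator (fun _ => -(R * r ^ 2)) z) :=
    setIntegral_mono_on (integrableOn_cap hK _) (hconst.add hind) hDm hub
  have h2 : ∫ z in D, ((R * θ / 2 * r ^ 2 + S * r * r ^ 2)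
        + D'.indicator (fun _ => -(R * r ^ 2)) z)
      = (R * θ / 2 * r ^ 2 + S * r * r ^ 2) * (volume D).toReal
        - R * r ^ 2 * (θ * (volume D).toReal) := by
    rw [integral_add hconst hind, setIntegral_const,
      setIntegral_indicator hD'm, Set.inter_eq_self_of_subset_right hD'D, setIntegral_const,
      Measure.real, Measure.real, hD', volume_preimage_two_smul_sub, smul_eq_mul, smul_eq_mul]
    ring
  refine h1.trans (h2.le.trans ?_)
  have hV : 0 ≤ (volume D).toReal := ENNReal.toReal_nonneg
  have h3 := mul_le_mul_of_nonneg_right hrS.le (mul_nonneg (sq_nonneg r) hV)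
  linarith

end Cases

/-- **Theorem 1, symmetric case (Meyer–Reisner).** A centrally symmetric convex body with
positive generalized Gauss curvature at some boundary point is not a local maximizer for
the isotropy constant among centrally symmetric convex bodies. -/
theorem not_local_maximizer_symmetric_of_posGenCurvature {n : ℕ} (hn : 2 ≤ n)
    (K : Set (EuclideanSpace ℝ (Fin n))) (hK : IsConvexBody K) (hsym : K = -K)
    (X₀ : EuclideanSpace ℝ (Fin n)) (hX₀ : X₀ ∈ frontier K)
    (hcurv : HasPosGenCurvature K X₀) :
    ∀ ε > (0 : ℝ), ∃ K' : Set (EuclideanSpace ℝ (Fin n)),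
      IsConvexBody K' ∧ K' = -K' ∧ hausdorffDist K' K < ε ∧ isoL n K < isoL n K' := by
  have hKs := forall_neg_mem_of_eq_neg hsym
  have h0 := zero_mem_interior_of_symm hK.2.1 hKs hK.2.2
  have hX₀K : X₀ ∈ K := hK.1.isClosed.frontier_subset hX₀
  obtain ⟨N, q, hq⟩ := hcurv
  have h := osculates_of_curvWitness hK h0 hX₀K hq
  intro ε hε
  rcases lt_trichotomy (isoDensity K X₀) 0 with hφ | hφ | hφ
  · exact exists_isoL_lt_of_isoDensity_neg hn hK hsym h hφ hε
  swap
  · exact exists_isoL_lt_of_isoDensity_pos hn hK hsym h hφ hε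
  by_cases htan : ∃ Y, ⟪Y, N⟫_ℝ = 0 ∧ ⟪X₀, inertiaOp K Y⟫_ℝ ≠ 0
  · obtain ⟨Y, hY, hne⟩ := htan
    rcases lt_or_gt_of_ne hne with hlt | hgt
    · exact exists_isoL_lt_of_tangential_pos hn hK hsym h hφ (Y₀ := -Y)
        (by rw [inner_neg_left, hY, neg_zero]) (by rw [map_neg, inner_neg_right]; linarith) hε
    · exact exists_isoL_lt_of_tangential_pos hn hK hsym h hφ hY hgt hε
  push Not at htan
  have hσ := inner_lt_zero_of_supporting h0 hq.1 hq.2.1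
  have hz : ∀ z, ⟪X₀, inertiaOp K z⟫_ℝ = ⟪z, N⟫_ℝ * ⟪X₀, inertiaOp K N⟫_ℝ := fun z => by
    have := htan _ (inner_projPerp hq.1 z)
    rw [projPerp_apply, map_sub, map_smul, inner_sub_right, real_inner_smul_right] at this
    linarith
  have hX₀ne : X₀ ≠ 0 := fun h => by simp [h] at hσ
  have hR : 0 < -⟪X₀, inertiaOp K N⟫_ℝ := by
    have := inner_inertiaOp_pos hK.1 hK.volume_pos hX₀ne
    rw [hz] at this
    exact neg_pos.2 (neg_of_mul_pos_right this hσ.le)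
  have hdens : ∀ z, isoDensity K (X₀ + z)
      = -2 * (-⟪X₀, inertiaOp K N⟫_ℝ) * ⟪z, N⟫_ℝ + ⟪z, inertiaOp K z⟫_ℝ := fun z => by
    rw [isoDensity_add, hφ, hz]; ring
  by_cases hcase : ∃ Y, ⟪Y, N⟫_ℝ = 0 ∧
      2 * (-⟪X₀, inertiaOp K N⟫_ℝ) * tangentForm N q Y Y < ⟪Y, inertiaOp K Y⟫_ℝ
  · obtain ⟨Y, hY, hlt⟩ := hcase
    exact exists_isoL_lt_of_curvature_lt hn hK hsym h hR hdens hY hlt hε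
  · push Not at hcase
    exact exists_isoL_lt_of_le_curvature hn hK hsym h hR hdens hcase hε
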